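/- arXiv:1203.2481 — 3 statements merged into one kernel-verified Lean document; each statement's English description precedes it below -/
import Mathlib

section
/- Let C ∈ 𝒜 satisfy QCP = 0 and let Δ : 𝒜 → ℳ be a linear map that is Jordan derivable at C. Set N = PΔ(Q)Q − QΔ(Q)P and define δ(A) = Δ(A) − (NA − AN) for A ∈ 𝒜 (so Δ − δ is an inner derivation). Then: (a) δ(P)A₁₂ = A₁₂δ(Q) for every A₁₂ ∈ 𝒜₁₂; (b) A₁₂δ(A₁₂) = δ(A₁₂)A₁₂ = 0 for every A₁₂ ∈ 𝒜₁₂; (c) δ(𝒜₁₁) ⊆ ℳ₁₁ and δ(𝒜₂₂) ⊆ ℳ₂₂. If moreover 𝒜₁₂ is left faithful with respect to ℳ, then (d) δ(P)A₁₁ = A₁₁δ(P) for every A₁₁ ∈ 𝒜₁₁, and (e) δ(A₁₁U₁₁) = δ(A₁₁)U₁₁ + A₁₁δ(U₁₁) − δ(P)A₁₁U₁₁ for all A₁₁, U₁₁ ∈ 𝒜₁₁ (so δ restricted to 𝒜₁₁ is a generalized derivation into ℳ₁₁). If 𝒜₁₂ is right faithful with respect to ℳ, then (f) δ(Q)A₂₂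 = A₂₂δ(Q) for every A₂₂ ∈ 𝒜₂₂, and (g) δ(V₂₂W₂₂) = δ(V₂₂)W₂₂ + V₂₂δ(W₂₂) − δ(Q)V₂₂W₂₂ for all V₂₂, W₂₂ ∈ 𝒜₂₂ (so δ restricted to 𝒜₂₂ is a generalized derivation into ℳ₂₂). -/
open MulOpposite

section Weights

variable {F V W : Type*} [Field F] [AddCommGroup V] [Module F V] [AddCommGroup W] [Module F W]

/-- A bilinear map vanishing along the family `(a + r x + s⁻¹ k, b - r s y + s e)` satisfies the
relations obtained by separating the weights in the scalars `r` and `s`. -/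
theorem LinearMap.separate_weights (Φ : V →ₗ[F] V →ₗ[F] W) (h2 : (2 : F) ≠ 0)
    {w : F} (hw : w ≠ 0) (hw2 : w ^ 2 ≠ 1) {a x k b y e : V}
    (h : ∀ r s : F, s ≠ 0 → Φ (a + r • x + s⁻¹ • k) (b - (r * s) • y + s • e) = 0) :
    Φ x y = 0 ∧ Φ x e = Φ a y ∧ Φ a e = 0 := by
  have E : ∀ r s : F, s ≠ 0 → Φ a b + s • Φ a e + s⁻¹ • Φ k b + Φ k e
      + r • (Φ x b + s • Φ x e - s • Φ a y - Φ k y) - (r * r * s) • Φ x y = 0 := by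
    intro r s hs
    rw [← h r s hs]
    simp only [map_add, map_sub, map_smul, LinearMap.add_apply, LinearMap.smul_apply]
    match_scalars <;> field_simp
  have h1 : (1 : F) ≠ 0 := one_ne_zero
  have hm : (-1 : F) ≠ 0 := neg_ne_zero.2 h1
  have hi1 : (1 : F)⁻¹ = 1 := inv_one
  have him : (-1 : F)⁻¹ = -1 := by norm_num
  have e01 := E 0 1 h1
  have e0m := E 0 (-1) hm
  have e0w := E 0 w hw
  have e11 := E 1 1 h1
  have em1 := E (-1) 1 h1
  have e1m := E 1 (-1) hm
  have emm := E (-1) (-1) hm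
  rw [hi1] at e01 e11 em1
  rw [him] at e0m e1m emm
  refine ⟨?_, ?_, ?_⟩
  · refine (smul_eq_zero.1 (?_ : (2 : F) • Φ x y = 0)).resolve_left h2
    linear_combination (norm := module) (2 : F) • e01 - e11 - em1
  · rw [← sub_eq_zero]
    refine (smul_eq_zero.1 (?_ : ((2 : F) * 2) • (Φ x e - Φ a y) = 0)).resolve_left
      (mul_ne_zero h2 h2)
    linear_combination (norm := module) e11 - em1 - (e1m - emm)
  · refine (smul_eq_zero.1 (?_ : ((2 : F) * (w ^ 2 - 1)) • Φ a e = 0)).resolve_left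
      (mul_ne_zero h2 (sub_ne_zero.2 hw2))
    have e0w' : w • Φ a b + (w * w) • Φ a e + Φ k b + w • Φ k e = 0 := by
      have := congrArg (w • ·) e0w
      simp only [smul_add, smul_sub, smul_smul, mul_inv_cancel₀ hw, zero_mul, mul_zero, zero_smul,
        smul_zero, sub_zero, add_zero, one_smul] at this
      exact this
    linear_combination (norm := module) (2 : F) • e0w' - w • (e01 + e0m) - (e01 - e0m)

end Weights

/-- A field of characteristic not two with at least four elements has a nonzero element whose
square is not one. -/
theorem exists_ne_zero_sq_ne_one {F : Type*} [Field F] (hcard : 4 ≤ Cardinal.mk F) :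
    ∃ w : F, w ≠ 0 ∧ w ^ 2 ≠ 1 := by
  classical
  by_contra! H
  have hsub : (Set.univ : Set F) ⊆ (({0, 1, -1} : Finset F) : Set F) := by
    intro w _
    rcases eq_or_ne w 0 with h | h
    · simp [h]
    · rcases (sq_eq_sq_iff_eq_or_eq_neg.1 ((H w h).trans (one_pow 2).symm)) with h | h <;> simp [h]
  have h3 : Cardinal.mk F ≤ 3 := by
    rw [← Cardinal.mk_univ]
    refine (Cardinal.mk_le_mk_of_subset hsub).trans ?_
    have h := Cardinal.mk_coe_finset (s := ({0, 1, -1} : Finset F))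
    refine h.le.trans ?_
    exact_mod_cast Finset.card_le_three
  exact absurd (hcard.trans h3) (by norm_num)

section Peirce

variable {R : Type*} [Ring R] {p q : R}

/-- Multiplication rules for an element of the corner `e R f`, where `e e' = 0` and `f' f = 0`. -/
theorem corner_mul_rules {e e' f f' a : R} (he : e * e = e) (hf : f * f = f) (hee : e' * e = 0)
    (hff : f * f' = 0) (ha : a = e * a * f) :
    (e * a = a ∧ a * f = a ∧ e' * a = 0 ∧ a * f' = 0) ∧
      ∀ z, e * (a * z) = a * z ∧ a * (f * z) = a * z ∧ e' * (a * z) = 0 ∧ a * (f' * z) = 0 := by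
  have h1 : e * a = a := by rw [ha, ← mul_assoc, ← mul_assoc, he]
  have h2 : a * f = a := by rw [ha, mul_assoc, hf]
  have h3 : e' * a = 0 := by rw [← h1, ← mul_assoc, hee, zero_mul]
  have h4 : a * f' = 0 := by rw [← h2, mul_assoc, hff, mul_zero]
  refine ⟨⟨h1, h2, h3, h4⟩, fun z => ?_⟩
  simp only [← mul_assoc, h1, h2, h3, h4, zero_mul, and_self]

/-- If `u ∘ q + a ∘ v = 0` where `a` lies in the `p`-corner and `v` is diagonal, then `u` lies in
the `p`-corner. -/
theorem eq_corner_of_jordan_eq_zero (hpq1 : p + q = 1) (hq : q * q = q) (hpq : p * q = 0)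
    (hqp : q * p = 0) (h2 : ∀ r : R, r + r = 0 → r = 0) {a u v : R} (hpa : p * a = a)
    (hap : a * p = a) (hv : p * v * q = 0) (hv' : q * v * p = 0)
    (h : a * v + v * a + q * u + u * q = 0) : u = p * u * p := by
  have hqa : q * a = 0 := by rw [← hpa, ← mul_assoc, hqp, zero_mul]
  have haq : a * q = 0 := by rw [← hap, mul_assoc, hpq, mul_zero]
  have hqa' (z : R) : q * (a * z) = 0 := by rw [← mul_assoc, hqa, zero_mul]
  have hqv : q * v = q * v * q := by
    linear_combination (norm := noncomm_ring) hv' - q * v * hpq1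
  have hvq : v * q = q * v * q := by
    linear_combination (norm := noncomm_ring) hv - hpq1 * (v * q)
  have hqva : q * (v * a) = 0 := by rw [← mul_assoc, hqv, mul_assoc, hqa, mul_zero]
  have havq : a * (v * q) = 0 := by rw [hvq, ← mul_assoc, ← mul_assoc, haq, zero_mul, zero_mul]
  have hqq' (z : R) : q * (q * z) = q * z := by rw [← mul_assoc, hq]
  have hpq' (z : R) : p * (q * z) = 0 := by rw [← mul_assoc, hpq, zero_mul]
  have h1 := congrArg (fun z => q * (z * q)) h
  have h3 := congrArg (fun z => p * (z * q)) h
  have h4 := congrArg (fun z => q * (z * p)) h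
  simp only [mul_add, add_mul, mul_assoc, hqa', hqva, havq, hqq', hpq', hq, hqp, haq, hap, mul_zero,
    zero_mul, zero_add, add_zero] at h1 h3 h4
  have h5 := h2 _ h1
  calc u = (p + q) * u * (p + q) := by rw [hpq1, one_mul, mul_one]
    _ = p * u * p + p * (u * q) + q * (u * p) + q * (u * q) := by noncomm_ring
    _ = p * u * p := by rw [h3, h4, h5, add_zero, add_zero, add_zero]

end Peirce

section Core

variable {F A R : Type*} [Field F] [Ring A] [Algebra F A] [Ring R] [Algebra F R]

/-- The bilinear obstruction for a linear map `D` to be a Jordan derivation along `ι`. -/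
def jordanDefect (ι : A →ₐ[F] R) (D : A →ₗ[F] R) : A →ₗ[F] A →ₗ[F] R :=
  LinearMap.mk₂ F (fun a b => ι a * D b + D b * ι a + ι b * D a + D a * ι b - D (a * b + b * a))
    (by intro a a' b; simp only [map_add, add_mul, mul_add]; abel)
    (by intro c a b; simp only [map_add, map_smul, smul_mul_assoc, mul_smul_comm, smul_add,
          smul_sub])
    (by intro a b b'; simp only [map_add, add_mul, mul_add]; abel)
    (by intro c a b; simp only [map_add, map_smul, smul_mul_assoc, mul_smul_comm, smul_add,
          smul_sub])

theorem jordanDefect_apply (ι : A →ₐ[F] R) (D : A →ₗ[F] R) (a b : A) :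
    jordanDefect ι D a b =
      ι a * D b + D b * ι a + ι b * D a + D a * ι b - D (a * b + b * a) := rfl

/-- The elements of the corner `p A p` that are invertible there. -/
def cornerUnits (p : A) : Set A :=
  {x : A | x = p * x * p ∧ ∃ y, y = p * y * p ∧ x * y = p ∧ y * x = p}

theorem IsIdempotentElem.mul_eq_of_corner {p a : A} (hp : p * p = p) (ha : a = p * a * p) :
    p * a = a ∧ a * p = a := by
  constructor
  · rw [ha, ← mul_assoc, ← mul_assoc, hp]
  · rw [ha, mul_assoc, hp]

theorem jordanDefect_relations (h2 : (2 : F) ≠ 0) {w : F} (hw : w ≠ 0) (hw2 : w ^ 2 ≠ 1)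
    {P Q C : A} (hP : P * P = P) (hQ : Q * Q = Q) (hPQ : P * Q = 0) (hQP : Q * P = 0)
    (h1 : P + Q = 1) (hC : Q * C * P = 0) (ι : A →ₐ[F] R) (D : A →ₗ[F] R)
    (hD : ∀ a b, a * b = C → jordanDefect ι D a b = 0)
    {a a' e e' x : A} (ha : a = P * a * P) (ha' : a' = P * a' * P) (haa : a * a' = P)
    (he : e = Q * e * Q) (he' : e' = Q * e' * Q) (hee : e' * e = Q) (hx : x = P * x * Q) :
    jordanDefect ι D x (a' * x * e) = 0 ∧
      jordanDefect ι D x e = jordanDefect ι D a (a' * x * e) ∧ jordanDefect ι D a e = 0 := by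
  obtain ⟨hPa, haP⟩ := IsIdempotentElem.mul_eq_of_corner hP ha
  obtain ⟨hPa', haP'⟩ := IsIdempotentElem.mul_eq_of_corner hP ha'
  obtain ⟨hQe, heQ⟩ := IsIdempotentElem.mul_eq_of_corner hQ he
  obtain ⟨hQe', heQ'⟩ := IsIdempotentElem.mul_eq_of_corner hQ he'
  have hPx : P * x = x := by rw [hx, ← mul_assoc, ← mul_assoc, hP]
  have hxQ : x * Q = x := by rw [hx, mul_assoc, hQ]
  have hQC : Q * C * Q = Q * C := by
    linear_combination (norm := noncomm_ring) Q * C * h1 - hC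
  have hae : a * e = 0 := by rw [← haP, ← hQe, mul_assoc, ← mul_assoc P, hPQ]; simp
  have hxa : x * a' = 0 := by rw [← hxQ, ← hPa', mul_assoc, ← mul_assoc Q, hQP]; simp
  have hea : e' * a' = 0 := by rw [← heQ', ← hPa', mul_assoc, ← mul_assoc Q, hQP]; simp
  refine LinearMap.separate_weights (jordanDefect ι D) h2 hw hw2
    (k := Q * C * Q * e') (b := a' * C) ?_
  intro r s hs
  apply hD
  have haa' (z : A) : a * (a' * z) = P * z := by rw [← mul_assoc, haa]
  have hxa' (z : A) : x * (a' * z) = 0 := by rw [← mul_assoc, hxa, zero_mul]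
  have hea' (z : A) : e' * (a' * z) = 0 := by rw [← mul_assoc, hea, zero_mul]
  have hPx' (z : A) : P * (x * z) = x * z := by rw [← mul_assoc, hPx]
  rw [mul_assoc] at hQC
  simp only [mul_add, add_mul, mul_sub, smul_mul_assoc, mul_smul_comm, mul_assoc, haa', hxa',
    hea', hPx', hae, hee, hQC, mul_zero, smul_zero, add_zero, zero_add]
  have : P * C + Q * C = C := by rw [← add_mul, h1, one_mul]
  rw [← sub_eq_zero, ← sub_eq_zero.2 this]
  match_scalars <;> field_simp
  ring

/-- The hypotheses on the idempotents `P` and `Q = 1 - P` and the map `D`, after removing the inner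
part, that are used throughout this section. -/
structure JordanPeirce (ι : A →ₐ[F] R) (D : A →ₗ[F] R) (P Q : A) : Prop where
  two_torsion : ∀ r : R, r + r = 0 → r = 0
  hP : P * P = P
  hQ : Q * Q = Q
  hPQ : P * Q = 0
  hQP : Q * P = 0
  add_eq_one : P + Q = 1
  left_right : ∀ a e, a = P * a * P → e = Q * e * Q → jordanDefect ι D a e = 0
  left_mul : ∀ a x, a = P * a * P → x = P * x * Q →
    jordanDefect ι D (a * x) Q = jordanDefect ι D a x
  mul_right : ∀ x e, x = P * x * Q → e = Q * e * Q →
    jordanDefect ι D x e = jordanDefect ι D P (x * e)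
  self_eq_zero : ∀ x, x = P * x * Q → jordanDefect ι D x x = 0
  map_pq : ι P * D Q * ι Q = 0
  map_qp : ι Q * D Q * ι P = 0

theorem JordanPeirce.of_span (h2 : (2 : F) ≠ 0) {w : F} (hw : w ≠ 0) (hw2 : w ^ 2 ≠ 1)
    {P Q C : A} (hP : P * P = P) (hQ1 : Q = 1 - P)
    (hinv₁ : ∀ a : A, P * a * P ∈ Submodule.span F (cornerUnits P))
    (hinv₂ : ∀ a : A, Q * a * Q ∈ Submodule.span F (cornerUnits Q))
    (hC : Q * C * P = 0) (ι : A →ₐ[F] R) (D : A →ₗ[F] R)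
    (hD : ∀ a b, a * b = C → jordanDefect ι D a b = 0)
    (hpq : ι P * D Q * ι Q = 0) (hqp : ι Q * D Q * ι P = 0) : JordanPeirce ι D P Q := by
  have hQ : Q * Q = Q := by rw [hQ1]; linear_combination (norm := noncomm_ring) hP
  have hPQ : P * Q = 0 := by rw [hQ1]; linear_combination (norm := noncomm_ring) -hP
  have hQP : Q * P = 0 := by rw [hQ1]; linear_combination (norm := noncomm_ring) -hP
  have h1 : P + Q = 1 := by rw [hQ1]; abel
  have hPP : P = P * P * P := by rw [hP, hP]
  have hQQ : Q = Q * Q * Q := by rw [hQ, hQ]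
  have rel {a a' e e' x : A} (ha : a = P * a * P) (ha' : a' = P * a' * P) (haa : a * a' = P)
      (he : e = Q * e * Q) (he' : e' = Q * e' * Q) (hee : e' * e = Q) (hx : x = P * x * Q) :=
    jordanDefect_relations h2 hw hw2 hP hQ hPQ hQP h1 hC ι D hD ha ha' haa he he' hee hx
  have hPx {x : A} (hx : x = P * x * Q) : P * x = x := by rw [hx, ← mul_assoc, ← mul_assoc, hP]
  have hxQ {x : A} (hx : x = P * x * Q) : x * Q = x := by rw [hx, mul_assoc, hQ]
  have ext₁ (L : A →ₗ[F] R) (hL : ∀ a ∈ cornerUnits P, L a = 0) {a : A} (ha : a = P * a * P) :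
      L a = 0 := by
    rw [ha]
    exact (Submodule.span_le.2 hL : _ ≤ LinearMap.ker L) (hinv₁ a)
  have ext₂ (L : A →ₗ[F] R) (hL : ∀ a ∈ cornerUnits Q, L a = 0) {a : A} (ha : a = Q * a * Q) :
      L a = 0 := by
    rw [ha]
    exact (Submodule.span_le.2 hL : _ ≤ LinearMap.ker L) (hinv₂ a)
  refine ⟨?_, hP, hQ, hPQ, hQP, h1, ?_, ?_, ?_, ?_, hpq, hqp⟩
  · intro r hr
    rw [← two_smul F r] at hr
    exact (smul_eq_zero.1 hr).resolve_left h2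
  · intro a e ha he
    refine ext₁ ((jordanDefect ι D).flip e) (fun a ha => ?_) ha
    refine ext₂ (jordanDefect ι D a) (fun e he => ?_) he
    obtain ⟨ha, a', ha', haa, -⟩ := ha
    obtain ⟨he, e', he', -, hee⟩ := he
    exact (rel (x := 0) ha ha' haa he he' hee (by simp)).2.2
  · intro a x ha hx
    refine sub_eq_zero.1 (ext₁ ((jordanDefect ι D).flip Q ∘ₗ LinearMap.mulRight F x
      - (jordanDefect ι D).flip x) (fun a ha => ?_) ha)
    obtain ⟨ha, a', ha', haa, haa'⟩ := ha
    have hax : a * x = P * (a * x) * Q := by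
      rw [mul_assoc, mul_assoc, hxQ hx, ← mul_assoc, (IsIdempotentElem.mul_eq_of_corner hP ha).1]
    have := (rel ha ha' haa hQQ hQQ hQ hax).2.1
    rw [← mul_assoc, haa', hPx hx, hxQ hx] at this
    exact sub_eq_zero.2 this
  · intro x e hx he
    refine sub_eq_zero.1 (ext₂ (jordanDefect ι D x - jordanDefect ι D P ∘ₗ LinearMap.mulLeft F x)
      (fun e he => ?_) he)
    obtain ⟨he, e', he', -, hee⟩ := he
    have := (rel hPP hPP hP he he' hee hx).2.1
    rw [hPx hx] at this
    exact sub_eq_zero.2 this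
  · intro x hx
    have := (rel hPP hPP hP hQQ hQQ hQ hx).1
    rwa [hPx hx, hxQ hx] at this

namespace JordanPeirce

variable {ι : A →ₐ[F] R} {D : A →ₗ[F] R} {P Q : A}

theorem map_corner (h : JordanPeirce ι D P Q) :
    (∀ a, a = P * a * P → D a = ι P * D a * ι P) ∧
      ∀ e, e = Q * e * Q → D e = ι Q * D e * ι Q := by
  obtain ⟨h2, hP, hQ, hPQ, hQP, h1, hae, -, -, -, hpq, hqp⟩ := h
  have hPP : P = P * P * P := by rw [hP, hP]
  have hQQ : Q = Q * Q * Q := by rw [hQ, hQ]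
  have hP' : ι P * ι P = ι P := by rw [← map_mul, hP]
  have hQ' : ι Q * ι Q = ι Q := by rw [← map_mul, hQ]
  have hPQ' : ι P * ι Q = 0 := by rw [← map_mul, hPQ, map_zero]
  have hQP' : ι Q * ι P = 0 := by rw [← map_mul, hQP, map_zero]
  have h1' : ι P + ι Q = 1 := by rw [← map_add, h1, map_one]
  have key {a e : A} (ha : a = P * a * P) (he : e = Q * e * Q) :
      ι a * D e + D e * ι a + ι e * D a + D a * ι e = 0 := by
    obtain ⟨hPa, haP⟩ := IsIdempotentElem.mul_eq_of_corner hP ha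
    obtain ⟨hQe, heQ⟩ := IsIdempotentElem.mul_eq_of_corner hQ he
    have h3 : a * e = 0 := by rw [← haP, ← hQe, mul_assoc, ← mul_assoc P, hPQ]; simp
    have h4 : e * a = 0 := by rw [← heQ, ← hPa, mul_assoc, ← mul_assoc Q, hQP]; simp
    have h5 := hae a e ha he
    rwa [jordanDefect_apply, h3, h4, add_zero, map_zero, sub_zero] at h5
  have hl (a : A) (ha : a = P * a * P) : D a = ι P * D a * ι P := by
    obtain ⟨hPa, haP⟩ := IsIdempotentElem.mul_eq_of_corner hP ha
    exact eq_corner_of_jordan_eq_zero h1' hQ' hPQ' hQP' h2 (by rw [← map_mul, hPa])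
      (by rw [← map_mul, haP]) hpq hqp (key ha hQQ)
  refine ⟨hl, fun e he => ?_⟩
  obtain ⟨hQe, heQ⟩ := IsIdempotentElem.mul_eq_of_corner hQ he
  refine eq_corner_of_jordan_eq_zero (a := ι e) (v := D P) ((add_comm _ _).trans h1') hP' hQP' hPQ'
    h2 (by rw [← map_mul, hQe]) (by rw [← map_mul, heQ]) ?_ ?_ ?_
  · rw [hl P hPP, ← mul_assoc, ← mul_assoc, hQP']; simp
  · rw [hl P hPP, mul_assoc, mul_assoc, hPQ']; simp
  · rw [← key hPP he]; abel

theorem idem_rules (h : JordanPeirce ι D P Q) :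
    (ι P * ι P = ι P ∧ ι Q * ι Q = ι Q ∧ ι P * ι Q = 0 ∧ ι Q * ι P = 0) ∧
      ∀ z, ι P * (ι P * z) = ι P * z ∧ ι Q * (ι Q * z) = ι Q * z ∧ ι P * (ι Q * z) = 0 ∧
        ι Q * (ι P * z) = 0 := by
  simp only [← mul_assoc, ← map_mul, h.hP, h.hQ, h.hPQ, h.hQP, map_zero, zero_mul, and_self,
    implies_true]

theorem left_rules (h : JordanPeirce ι D P Q) {a : R} (ha : a = ι P * a * ι P) :
    (ι P * a = a ∧ a * ι P = a ∧ ι Q * a = 0 ∧ a * ι Q = 0) ∧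
      ∀ z, ι P * (a * z) = a * z ∧ a * (ι P * z) = a * z ∧ ι Q * (a * z) = 0 ∧
        a * (ι Q * z) = 0 :=
  have H := h.idem_rules.1
  corner_mul_rules H.1 H.1 H.2.2.2 H.2.2.1 ha

theorem right_rules (h : JordanPeirce ι D P Q) {a : R} (ha : a = ι Q * a * ι Q) :
    (ι Q * a = a ∧ a * ι Q = a ∧ ι P * a = 0 ∧ a * ι P = 0) ∧
      ∀ z, ι Q * (a * z) = a * z ∧ a * (ι Q * z) = a * z ∧ ι P * (a * z) = 0 ∧
        a * (ι P * z) = 0 :=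
  have H := h.idem_rules.1
  corner_mul_rules H.2.1 H.2.1 H.2.2.1 H.2.2.2 ha

theorem off_rules (h : JordanPeirce ι D P Q) {a : R} (ha : a = ι P * a * ι Q) :
    (ι P * a = a ∧ a * ι Q = a ∧ ι Q * a = 0 ∧ a * ι P = 0) ∧
      ∀ z, ι P * (a * z) = a * z ∧ a * (ι Q * z) = a * z ∧ ι Q * (a * z) = 0 ∧
        a * (ι P * z) = 0 :=
  have H := h.idem_rules.1
  corner_mul_rules H.1 H.2.1 H.2.2.2 H.2.2.2 ha

theorem map_sandwich {a b c : A} (ha : a = b * a * c) : ι a = ι b * ι a * ι c := by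
  rw [← map_mul, ← map_mul, ← ha]

theorem P_mem (h : JordanPeirce ι D P Q) : P = P * P * P := by rw [h.hP, h.hP]

theorem Q_mem (h : JordanPeirce ι D P Q) : Q = Q * Q * Q := by rw [h.hQ, h.hQ]

theorem left_mul_mem (h : JordanPeirce ι D P Q) {a x : A} (ha : a = P * a * P)
    (hx : x = P * x * Q) : a * x = P * (a * x) * Q := by
  rw [((corner_mul_rules h.hP h.hP h.hQP h.hPQ ha).2 x).1, mul_assoc,
    (corner_mul_rules h.hP h.hQ h.hQP h.hQP hx).1.2.1]

theorem mul_right_mem (h : JordanPeirce ι D P Q) {x e : A} (hx : x = P * x * Q)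
    (he : e = Q * e * Q) : x * e = P * (x * e) * Q := by
  rw [((corner_mul_rules h.hP h.hQ h.hQP h.hQP hx).2 e).1, mul_assoc,
    (corner_mul_rules h.hQ h.hQ h.hPQ h.hQP he).1.2.1]

/-- The action of `D` on the off-diagonal corner, compressed to that corner. -/
theorem compress_left_mul (h : JordanPeirce ι D P Q) {a x : A} (ha : a = P * a * P)
    (hx : x = P * x * Q) :
    ι P * D (a * x) * ι Q + ι a * ι x * D Q = D a * ι x + ι a * (ι P * D x * ι Q) := by
  have rx := corner_mul_rules h.hP h.hQ h.hQP h.hQP hx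
  have ra := corner_mul_rules h.hP h.hP h.hQP h.hPQ ha
  have key := h.left_mul a x ha hx
  have hax : Q * (a * x) = 0 := (ra.2 x).2.2.1
  have hxa : x * a = 0 := by rw [← ra.1.1, (rx.2 a).2.2.2]
  rw [jordanDefect_apply, jordanDefect_apply, mul_assoc a x Q, rx.1.2.1, hax, hxa,
    sub_left_inj, map_mul ι] at key
  have key' := congrArg (fun z => ι P * (z * ι Q)) key
  simpa only [mul_add, add_mul, mul_assoc, h.idem_rules, h.left_rules (map_sandwich ha),
    h.off_rules (map_sandwich hx), h.left_rules (h.map_corner.1 a ha),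
    h.right_rules (h.map_corner.2 Q h.Q_mem), mul_zero, zero_mul, add_zero, zero_add,
    add_comm] using key'

theorem compress_mul_right (h : JordanPeirce ι D P Q) {x e : A} (hx : x = P * x * Q)
    (he : e = Q * e * Q) :
    ι P * D x * ι Q * ι e + ι x * D e = D P * ι x * ι e + ι P * D (x * e) * ι Q := by
  have rx := corner_mul_rules h.hP h.hQ h.hQP h.hQP hx
  have re := corner_mul_rules h.hQ h.hQ h.hPQ h.hQP he
  have key := h.mul_right x e hx he
  have hex : e * x = 0 := by rw [← re.1.2.1, mul_assoc, rx.1.2.2.1, mul_zero]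
  have hxe : x * e * P = 0 := by rw [mul_assoc, re.1.2.2.2, mul_zero]
  rw [jordanDefect_apply, jordanDefect_apply, ← mul_assoc P x e, rx.1.1, hex, hxe,
    sub_left_inj, map_mul ι] at key
  have key' := congrArg (fun z => ι P * (z * ι Q)) key
  simpa only [mul_add, add_mul, mul_assoc, h.idem_rules, h.right_rules (map_sandwich he),
    h.off_rules (map_sandwich hx), h.left_rules (h.map_corner.1 P h.P_mem),
    h.right_rules (h.map_corner.2 e he), mul_zero, zero_mul, add_zero, zero_add,
    add_comm] using key'

theorem diag_off_diag (h : JordanPeirce ι D P Q) {x : A} (hx : x = P * x * Q) :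
    ι P * D x * ι P = 0 ∧ ι Q * D x * ι Q = 0 := by
  have rx := corner_mul_rules h.hP h.hQ h.hQP h.hQP hx
  have key := h.left_mul P x h.P_mem hx
  rw [rx.1.1, jordanDefect_apply, jordanDefect_apply, rx.1.2.1, rx.1.2.2.1, rx.1.1, rx.1.2.2.2,
    sub_left_inj] at key
  have hxP : ι x * D P = 0 := by
    rw [← (h.left_rules (h.map_corner.1 P h.P_mem)).1.1,
      ((h.off_rules (map_sandwich hx)).2 (D P)).2.2.2]
  have hQx : D Q * ι x = 0 := by
    rw [← (h.right_rules (h.map_corner.2 Q h.Q_mem)).1.2.1, mul_assoc,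
      (h.off_rules (map_sandwich hx)).1.2.2.1, mul_zero]
  have key₁ := congrArg (fun z => ι P * (z * ι P)) key
  have key₂ := congrArg (fun z => ι Q * (z * ι Q)) key
  simp only [mul_add, add_mul, mul_assoc, h.idem_rules, h.off_rules (map_sandwich hx),
    h.left_rules (h.map_corner.1 P h.P_mem), h.right_rules (h.map_corner.2 Q h.Q_mem),
    hxP, hQx, mul_zero, add_zero, zero_add] at key₁ key₂
  rw [mul_assoc, mul_assoc]
  exact ⟨h.two_torsion _ key₁.symm, h.two_torsion _ key₂⟩

theorem map_mul_off_diag (h : JordanPeirce ι D P Q) {x : A} (hx : x = P * x * Q) :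
    D P * ι x = ι x * D Q := by
  have key := h.compress_left_mul h.P_mem hx
  rw [(corner_mul_rules h.hP h.hQ h.hQP h.hQP hx).1.1] at key
  simp only [mul_assoc, h.idem_rules, h.off_rules (map_sandwich hx)] at key
  rw [add_comm] at key
  exact (add_right_cancel key).symm

theorem off_diag_mul_self (h : JordanPeirce ι D P Q) {x : A} (hx : x = P * x * Q) :
    ι x * D x = 0 ∧ D x * ι x = 0 := by
  have rx := h.off_rules (map_sandwich (ι := ι) hx)
  have hxx : x * x = 0 := by
    have rx := corner_mul_rules h.hP h.hQ h.hQP h.hQP hx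
    rw [← rx.1.1, ← mul_assoc, mul_assoc P, mul_assoc P, rx.1.2.2.2]
    simp
  have key := h.self_eq_zero x hx
  rw [jordanDefect_apply, hxx, add_zero, map_zero, sub_zero, add_assoc] at key
  have key₀ := h.two_torsion _ key
  have key₁ := congrArg (fun z => z * ι P) key₀
  simp only [add_mul, mul_assoc, rx, mul_zero, zero_mul, add_zero] at key₁
  have key₂ := congrArg (fun z => ι x * z) (h.diag_off_diag hx).2
  simp only [mul_assoc, rx, mul_zero] at key₂
  have hzero : ι x * D x = 0 := by
    rw [← mul_one (D x), ← map_one ι, ← h.add_eq_one, map_add, mul_add, mul_add, key₁, key₂,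
      add_zero]
  exact ⟨hzero, by rwa [hzero, zero_add] at key₀⟩

theorem left_commute (h : JordanPeirce ι D P Q) {a x : A} (ha : a = P * a * P)
    (hx : x = P * x * Q) : (ι a * D P - D P * ι a) * ι x = 0 := by
  have key := h.map_mul_off_diag (h.left_mul_mem ha hx)
  rw [map_mul] at key
  linear_combination (norm := noncomm_ring) ι a * h.map_mul_off_diag hx - key

theorem right_commute (h : JordanPeirce ι D P Q) {e x : A} (he : e = Q * e * Q)
    (hx : x = P * x * Q) : ι x * (ι e * D Q - D Q * ι e) = 0 := by
  have key := h.map_mul_off_diag (h.mul_right_mem hx he)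
  rw [map_mul] at key
  linear_combination (norm := noncomm_ring) h.map_mul_off_diag hx * ι e - key

theorem left_derivation (h : JordanPeirce ι D P Q) {a u x : A} (ha : a = P * a * P)
    (hu : u = P * u * P) (hx : x = P * x * Q) :
    (D (a * u) - (D a * ι u + ι a * D u - D P * ι (a * u))) * ι x = 0 := by
  have k₁ := h.compress_left_mul (a := a * u) (by
    rw [← mul_assoc, (corner_mul_rules h.hP h.hP h.hQP h.hPQ ha).1.1, mul_assoc,
      (corner_mul_rules h.hP h.hP h.hQP h.hPQ hu).1.2.1]) hx
  have k₂ := h.compress_left_mul ha (h.left_mul_mem hu hx)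
  have k₃ := h.compress_left_mul hu hx
  have k₄ := h.map_mul_off_diag (h.left_mul_mem ha (h.left_mul_mem hu hx))
  rw [mul_assoc] at k₁
  simp only [map_mul ι] at *
  linear_combination (norm := noncomm_ring) k₂ - k₁ + ι a * k₃ + k₄

theorem right_derivation (h : JordanPeirce ι D P Q) {v w x : A} (hv : v = Q * v * Q)
    (hw : w = Q * w * Q) (hx : x = P * x * Q) :
    ι x * (D (v * w) - (D v * ι w + ι v * D w - D Q * ι (v * w))) = 0 := by
  have k₁ := h.compress_mul_right (e := v * w) hx (by
    rw [← mul_assoc, (corner_mul_rules h.hQ h.hQ h.hPQ h.hQP hv).1.1, mul_assoc,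
      (corner_mul_rules h.hQ h.hQ h.hPQ h.hQP hw).1.2.1])
  have k₂ := h.compress_mul_right (h.mul_right_mem hx hv) hw
  have k₃ := h.compress_mul_right hx hv
  have k₄ := h.map_mul_off_diag hx
  rw [← mul_assoc] at k₁
  simp only [map_mul ι] at *
  linear_combination (norm := noncomm_ring) k₁ - k₂ - k₃ * ι w - k₄ * ι v * ι w

end JordanPeirce

end Core

/-- characterization of maps Jordan derivable at `C` with `QCP = 0`,
in terms of the Peirce decomposition of `A` relative to the nontrivial idempotent `P`. -/
theorem statement2 {𝔽 A M : Type*} [Field 𝔽] [Ring A] [Algebra 𝔽 A]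
    [AddCommGroup M] [Module 𝔽 M] [Module A M] [Module Aᵐᵒᵖ M]
    [SMulCommClass A Aᵐᵒᵖ M] [IsScalarTower 𝔽 A M] [IsScalarTower 𝔽 Aᵐᵒᵖ M]
    -- the field has characteristic ≠ 2 and at least 4 elements
    (hchar : (2 : 𝔽) ≠ 0) (hcard : 4 ≤ Cardinal.mk 𝔽)
    -- `P` is a nontrivial idempotent, `Q = 1 - P`
    (P Q : A) (hP : P * P = P) (hP0 : P ≠ 0) (hP1 : P ≠ 1) (hQ : Q = 1 - P)
    -- every element of `A₁₁` is a linear combination of elements invertible in `A₁₁`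
    (hinv₁ : ∀ a : A, P * a * P ∈ Submodule.span 𝔽
      {x : A | x = P * x * P ∧ ∃ y, y = P * y * P ∧ x * y = P ∧ y * x = P})
    -- every element of `A₂₂` is a linear combination of elements invertible in `A₂₂`
    (hinv₂ : ∀ a : A, Q * a * Q ∈ Submodule.span 𝔽
      {x : A | x = Q * x * Q ∧ ∃ y, y = Q * y * Q ∧ x * y = Q ∧ y * x = Q})
    -- `C ∈ A` with `C₂₁ = QCP = 0`
    (C : A) (hC : Q * C * P = 0)
    -- `Δ` is Jordan derivable at `C`
    (Δ : A →ₗ[𝔽] M)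
    (hΔ : ∀ a b : A, a * b = C →
      Δ (a * b + b * a) = a • Δ b + op a • Δ b + b • Δ a + op b • Δ a)
    -- `N = PΔ(Q)Q − QΔ(Q)P` and `δ(a) = Δ(a) − (Na − aN)`, so `Δ − δ` is inner
    (N : M) (hN : N = P • (op Q • Δ Q) - Q • (op P • Δ Q))
    (δ : A → M) (hδ : ∀ a, δ a = Δ a - (op a • N - a • N)) :
    -- (a) δ(P)A₁₂ = A₁₂δ(Q)
    ((∀ a : A, op (P * a * Q) • δ P = (P * a * Q) • δ Q) ∧
    -- (b) A₁₂δ(A₁₂) = δ(A₁₂)A₁₂ = 0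
     (∀ a : A, (P * a * Q) • δ (P * a * Q) = 0 ∧ op (P * a * Q) • δ (P * a * Q) = 0) ∧
    -- (c) δ(A₁₁) ⊆ M₁₁ and δ(A₂₂) ⊆ M₂₂
     (∀ a : A, δ (P * a * P) = P • (op P • δ (P * a * P)) ∧
       δ (Q * a * Q) = Q • (op Q • δ (Q * a * Q)))) ∧
    -- if A₁₂ is left faithful with respect to M:
    ((∀ m : M, (∀ a : A, op (P * a * Q) • m = 0) → op P • m = 0) →
      -- (d) δ(P) ∈ C(A₁₁, M)
      ((∀ a : A, (P * a * P) • δ P = op (P * a * P) • δ P) ∧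
      -- (e) δ|A₁₁ is a generalized derivation into M₁₁
       (∀ a u : A, δ ((P * a * P) * (P * u * P)) =
         op (P * u * P) • δ (P * a * P) + (P * a * P) • δ (P * u * P)
           - op ((P * a * P) * (P * u * P)) • δ P))) ∧
    -- if A₁₂ is right faithful with respect to M:
    ((∀ m : M, (∀ a : A, (P * a * Q) • m = 0) → Q • m = 0) →
      -- (f) δ(Q) ∈ C(A₂₂, M)
      ((∀ a : A, (Q * a * Q) • δ Q = op (Q * a * Q) • δ Q) ∧
      -- (g) δ|A₂₂ is a generalized derivation into M₂₂
       (∀ v w : A, δ ((Q * v * Q) * (Q * w * Q)) =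
         op (Q * w * Q) • δ (Q * v * Q) + (Q * v * Q) • δ (Q * w * Q)
           - op ((Q * v * Q) * (Q * w * Q)) • δ Q))) := by
  obtain ⟨w, hw, hw2⟩ := exists_ne_zero_sq_ne_one hcard
  have hQQ : Q * Q = Q := by rw [hQ]; linear_combination (norm := noncomm_ring) hP
  have hPQ : P * Q = 0 := by rw [hQ]; linear_combination (norm := noncomm_ring) -hP
  have hQP : Q * P = 0 := by rw [hQ]; linear_combination (norm := noncomm_ring) -hP
  have swap (a b : A) (m : M) : op a • b • m = b • op a • m := (smul_comm b (op a) m).symm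
  have hadd (a b : A) : δ (a + b) = δ a + δ b := by
    simp only [hδ, map_add, op_add, add_smul]; abel
  have hsmul (c : 𝔽) (a : A) : δ (c • a) = c • δ a := by
    simp only [hδ, map_smul, op_smul, smul_assoc, smul_sub]
  let ι : A →ₐ[𝔽] TrivSqZeroExt A M := TrivSqZeroExt.inlAlgHom 𝔽 A M
  let D : A →ₗ[𝔽] TrivSqZeroExt A M :=
    { toFun := fun a => TrivSqZeroExt.inr (δ a)
      map_add' := fun a b => by rw [hadd, TrivSqZeroExt.inr_add]
      map_smul' := fun c a => by rw [hsmul, TrivSqZeroExt.inr_smul, RingHom.id_apply] }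
  have hl (a : A) (m : M) :
      ι a * TrivSqZeroExt.inr m = TrivSqZeroExt.inr (a • m) := TrivSqZeroExt.inl_mul_inr a m
  have hr (a : A) (m : M) :
      TrivSqZeroExt.inr m * ι a = TrivSqZeroExt.inr (op a • m) := TrivSqZeroExt.inr_mul_inl a m
  have hDa (a : A) : D a = TrivSqZeroExt.inr (δ a) := rfl
  have hinj {m m' : M} (h : (TrivSqZeroExt.inr m : TrivSqZeroExt A M) = TrivSqZeroExt.inr m') :
      m = m' := TrivSqZeroExt.inr_injective h
  have hzero {m : M} (h : (TrivSqZeroExt.inr m : TrivSqZeroExt A M) = 0) : m = 0 :=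
    hinj (h.trans (TrivSqZeroExt.inr_zero A).symm)
  have hD (a b : A) (hab : a * b = C) : jordanDefect ι D a b = 0 := by
    rw [jordanDefect_apply]
    simp only [hDa, hl, hr, ← TrivSqZeroExt.inr_add, ← TrivSqZeroExt.inr_sub]
    rw [← TrivSqZeroExt.inr_zero A]
    congr 1
    simp only [hδ, hΔ a b hab, smul_sub, op_add, op_mul, add_smul, mul_smul]
    rw [smul_comm a (op b) N, smul_comm b (op a) N]
    abel
  have hΔQ : P • op Q • δ Q = 0 ∧ Q • op P • δ Q = 0 := by
    have hl (a b : A) (m : M) : a • b • m = (a * b) • m := (mul_smul a b m).symm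
    have hr (a b : A) (m : M) : op a • op b • m = op (b * a) • m := by rw [op_mul, mul_smul]
    simp only [hδ, hN, smul_sub, swap, hl, hr, hP, hQQ, hPQ, hQP, op_zero, zero_smul, smul_zero,
      sub_zero, zero_sub, sub_neg_eq_add, smul_add, add_zero, zero_add, sub_self, and_self]
  have h : JordanPeirce ι D P Q := by
    refine JordanPeirce.of_span hchar hw hw2 hP hQ hinv₁ hinv₂ hC ι D hD ?_ ?_
    · rw [hDa, hl, hr, swap, hΔQ.1, TrivSqZeroExt.inr_zero]
    · rw [hDa, hl, hr, swap, hΔQ.2, TrivSqZeroExt.inr_zero]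
  have m₁ (a : A) : P * a * P = P * (P * a * P) * P := by
    simp only [mul_assoc, hP]; simp only [← mul_assoc, hP]
  have m₂ (a : A) : Q * a * Q = Q * (Q * a * Q) * Q := by
    simp only [mul_assoc, hQQ]; simp only [← mul_assoc, hQQ]
  have mx (a : A) : P * a * Q = P * (P * a * Q) * Q := by
    simp only [mul_assoc, hQQ]; simp only [← mul_assoc, hP]
  have c₁ (a : A) (ha : a = P * a * P) : δ a = P • op P • δ a := by
    have := h.map_corner.1 a ha
    rw [hDa, hl, hr] at this
    rw [← swap]
    exact hinj this
  have c₂ (a : A) (ha : a = Q * a * Q) : δ a = Q • op Q • δ a := by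
    have := h.map_corner.2 a ha
    rw [hDa, hl, hr] at this
    rw [← swap]
    exact hinj this
  refine ⟨⟨fun a => ?_, fun a => ?_, fun a => ⟨c₁ _ (m₁ a), c₂ _ (m₂ a)⟩⟩, fun hf => ?_,
    fun hf => ?_⟩
  · have := h.map_mul_off_diag (mx a)
    rw [hDa, hDa, hl, hr] at this
    exact hinj this
  · have := h.off_diag_mul_self (mx a)
    rw [hDa, hl, hr] at this
    exact ⟨hzero this.1, hzero this.2⟩
  · have hf' {m : M} (hm : op P • m = m)
        (H : ∀ x, x = P * x * Q → (TrivSqZeroExt.inr m : TrivSqZeroExt A M) * ι x = 0) : m = 0 := by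
      rw [← hm]
      refine hf m fun a => hzero ?_
      rw [← hr, H _ (mx a)]
    have hPa (a : A) (ha : a = P * a * P) (m : M) : op P • op a • m = op a • m := by
      rw [← mul_smul, ← op_mul, (IsIdempotentElem.mul_eq_of_corner hP ha).2]
    have hPδ (a : A) (ha : a = P * a * P) : op P • δ a = δ a := by
      rw [c₁ a ha, swap, ← mul_smul (op P), ← op_mul, hP]
    have hau (a u : A) : P * a * P * (P * u * P) = P * (P * a * P * (P * u * P)) * P := by
      simp only [mul_assoc, hP]; simp only [← mul_assoc, hP]
    refine ⟨fun a => sub_eq_zero.1 (hf' ?_ fun x hx => ?_),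
      fun a u => sub_eq_zero.1 (hf' ?_ fun x hx => ?_)⟩
    · rw [smul_sub, swap, hPδ P h.P_mem, hPa _ (m₁ a)]
    · have := h.left_commute (m₁ a) hx
      rwa [hDa, hl, hr, ← TrivSqZeroExt.inr_sub] at this
    · rw [smul_sub, smul_sub, smul_add, swap, hPδ _ (m₁ u), hPδ _ (hau a u), hPa _ (m₁ u),
        hPa _ (hau a u)]
    · have := h.left_derivation (m₁ a) (m₁ u) hx
      rwa [hDa, hDa, hDa, hDa, hl, hr, hr, ← TrivSqZeroExt.inr_add, ← TrivSqZeroExt.inr_sub,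
        ← TrivSqZeroExt.inr_sub] at this
  · have hf' {m : M} (hm : Q • m = m)
        (H : ∀ x, x = P * x * Q → ι x * (TrivSqZeroExt.inr m : TrivSqZeroExt A M) = 0) : m = 0 := by
      rw [← hm]
      refine hf m fun a => hzero ?_
      rw [← hl, H _ (mx a)]
    have hQa (a : A) (ha : a = Q * a * Q) (m : M) : Q • a • m = a • m := by
      rw [← mul_smul, (IsIdempotentElem.mul_eq_of_corner hQQ ha).1]
    have hQδ (a : A) (ha : a = Q * a * Q) : Q • δ a = δ a := by
      rw [c₂ a ha, ← mul_smul, hQQ]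
    have hvw (v w : A) : Q * v * Q * (Q * w * Q) = Q * (Q * v * Q * (Q * w * Q)) * Q := by
      simp only [mul_assoc, hQQ]; simp only [← mul_assoc, hQQ]
    refine ⟨fun a => sub_eq_zero.1 (hf' ?_ fun x hx => ?_),
      fun v w => sub_eq_zero.1 (hf' ?_ fun x hx => ?_)⟩
    · rw [smul_sub, ← swap, hQδ Q h.Q_mem, hQa _ (m₂ a)]
    · have := h.right_commute (m₂ a) hx
      rwa [hDa, hl, hr, ← TrivSqZeroExt.inr_sub] at this
    · rw [smul_sub, smul_sub, smul_add, ← swap, ← swap, hQδ _ (m₂ v), hQδ _ (hvw v w),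
        hQa _ (m₂ v), hQδ Q h.Q_mem]
    · have := h.right_derivation (m₂ v) (m₂ w) hx
      rwa [hDa, hDa, hDa, hDa, hl, hr, hr, ← TrivSqZeroExt.inr_add, ← TrivSqZeroExt.inr_sub,
        ← TrivSqZeroExt.inr_sub] at this
end

section
/- Suppose 𝒜₁₂ is faithful to ℬ and C(T_𝒜, ℬ) = 𝔽I. If a linear map δ : 𝒜 → ℬ is Jordan derivable at some C ∈ T_𝒜, then the restriction of δ to T_𝒜 is a derivation from T_𝒜 to ℬ, i.e. δ(AB) = δ(A)B + Aδ(B) for all A, B ∈ T_𝒜. -/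
/-- `D` satisfies the Jordan-derivation identity at the pair `(a, b)`. -/
def JordanLeibniz {B : Type*} [Ring B] (D : B → B) (a b : B) : Prop :=
  D (a * b + b * a) = D a * b + a * D b + D b * a + b * D a

/-- `M₁`, `M`, `M₂` are the corners `P𝒜P`, `P𝒜Q`, `Q𝒜Q` of a subalgebra `𝒜` of `B` with respect
to complementary idempotents `P`, `Q`, where `M` is faithful to `B` and only scalars commute with
all three corners. -/
structure TriangularPeirce {𝔽 B : Type*} [Field 𝔽] [Ring B] [Algebra 𝔽 B] (𝒜 : Subalgebra 𝔽 B)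
    (P Q : B) (M₁ M M₂ : Submodule 𝔽 B) : Prop where
  add_eq_one : P + Q = 1
  mul_PQ : P * Q = 0
  mul_QP : Q * P = 0
  memP : P ∈ M₁
  memQ : Q ∈ M₂
  le₁ : ∀ x ∈ M₁, x ∈ 𝒜
  le : ∀ s ∈ M, s ∈ 𝒜
  le₂ : ∀ w ∈ M₂, w ∈ 𝒜
  left₁ : ∀ x ∈ M₁, P * x = x
  right₁ : ∀ x ∈ M₁, x * P = x
  left : ∀ s ∈ M, P * s = s
  right : ∀ s ∈ M, s * Q = s
  left₂ : ∀ w ∈ M₂, Q * w = w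
  right₂ : ∀ w ∈ M₂, w * Q = w
  mul₁₁ : ∀ x ∈ M₁, ∀ y ∈ M₁, x * y ∈ M₁
  mul₁ : ∀ x ∈ M₁, ∀ s ∈ M, x * s ∈ M
  mul₂ : ∀ s ∈ M, ∀ w ∈ M₂, s * w ∈ M
  mul₂₂ : ∀ w ∈ M₂, ∀ v ∈ M₂, w * v ∈ M₂
  faithful_left : ∀ n : B, (∀ s ∈ M, n * s = 0) → n * P = 0
  faithful_right : ∀ n : B, (∀ s ∈ M, s * n = 0) → Q * n = 0
  span₁ : ∀ x ∈ M₁, x ∈ Submodule.span 𝔽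
    {x : B | x ∈ M₁ ∧ ∃ y ∈ M₁, x * y = P ∧ y * x = P}
  span₂ : ∀ w ∈ M₂, w ∈ Submodule.span 𝔽
    {w : B | w ∈ M₂ ∧ ∃ v ∈ M₂, w * v = Q ∧ v * w = Q}
  center : ∀ n : B, (∀ x ∈ M₁, x * n = n * x) → (∀ s ∈ M, s * n = n * s) →
    (∀ w ∈ M₂, w * n = n * w) → ∃ k : 𝔽, n = k • (1 : B)

/-- The bilinear identities satisfied by a map that is Jordan derivable at a point, with no
reference to the point. -/
structure CornerRelations {𝔽 B : Type*} [Field 𝔽] [Ring B] [Algebra 𝔽 B]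
    (M₁ M M₂ : Submodule 𝔽 B) (D : B →ₗ[𝔽] B) : Prop where
  diag : ∀ x ∈ M₁, ∀ w ∈ M₂, D x * w + w * D x + (x * D w + D w * x) = 0
  mixed : ∀ x ∈ M₁, ∀ s ∈ M, ∀ w ∈ M₂,
    D (x * s) * w + w * D (x * s) + (x * s * D w + D w * (x * s)) =
      D x * (s * w) + s * w * D x + (x * D (s * w) + D (s * w) * x)
  square : ∀ s ∈ M, D s * s + s * D s = 0

section Scalars

variable {𝔽 : Type*} [Field 𝔽]

theorem exists_ne_zero_one_neg_one (hcard : 4 ≤ Cardinal.mk 𝔽) :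
    ∃ t : 𝔽, t ≠ 0 ∧ t ≠ 1 ∧ t ≠ -1 := by
  classical
  by_contra! h
  have hs : ∀ t : 𝔽, t ∈ ({0, 1, -1} : Finset 𝔽) := by
    intro t
    have := h t
    simp only [Finset.mem_insert, Finset.mem_singleton]
    tauto
  have h1 : Cardinal.mk 𝔽 ≤ 3 := by
    have := (Cardinal.mk_le_iff_forall_finset_subset_card_le (n := 3) (t := (Set.univ : Set 𝔽))).2
      (fun s _ => (Finset.card_le_card (fun t _ => hs t)).trans Finset.card_le_three)
    simpa using this
  have h2 := hcard.trans h1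
  norm_cast at h2

theorem eq_zero_of_laurent {V : Type*} [AddCommGroup V] [Module 𝔽 V] (hchar : (2 : 𝔽) ≠ 0)
    (ht : ∃ t : 𝔽, t ≠ 0 ∧ t ≠ 1 ∧ t ≠ -1) {u v w : V}
    (h : ∀ t : 𝔽, t ≠ 0 → t • u + v + t⁻¹ • w = 0) : u = 0 ∧ v = 0 ∧ w = 0 := by
  obtain ⟨t, h0, h1, h2⟩ := ht
  have e1 := h 1 one_ne_zero
  have e2 := h (-1) (neg_ne_zero.2 one_ne_zero)
  have e3 := h t h0
  simp only [one_smul, inv_one, inv_neg, neg_smul] at e1 e2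
  have hv : v = 0 := by
    have : (2 : 𝔽) • v = 0 := by
      have e := congrArg₂ (· + ·) e1 e2
      simp only [add_zero] at e
      rw [two_smul, ← e]
      abel
    exact (smul_eq_zero.1 this).resolve_left hchar
  subst hv
  have hw : w = -u := by
    rw [add_zero] at e1
    exact (neg_eq_of_add_eq_zero_right e1).symm
  subst hw
  have hu : (t - t⁻¹) • u = 0 := by
    rw [← e3]
    module
  have hne : t - t⁻¹ ≠ 0 := by
    intro hh
    have : (t - 1) * (t + 1) = 0 := by
      field_simp at hh
      linear_combination hh
    rcases mul_eq_zero.1 this with h' | h'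
    · exact h1 (sub_eq_zero.1 h')
    · exact h2 (eq_neg_of_add_eq_zero_left h')
  have hu0 := (smul_eq_zero.1 hu).resolve_left hne
  simp [hu0]

end Scalars

section Jordan

variable {𝔽 B : Type*} [Field 𝔽] [Ring B] [Algebra 𝔽 B]

theorem jordan_eq_zero_of_scaling (hchar : (2 : 𝔽) ≠ 0) (ht : ∃ t : 𝔽, t ≠ 0 ∧ t ≠ 1 ∧ t ≠ -1)
    (D : B →ₗ[𝔽] B) {a₀ a₁ b₀ b₁ : B} (h₀₁ : a₀ * b₁ = 0) (h₁₀ : a₁ * b₀ = 0) (hba : b₁ * a₀ = 0)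
    (h : ∀ t : 𝔽, t ≠ 0 → JordanLeibniz D (a₀ + t⁻¹ • a₁) (b₀ + t • b₁)) :
    D a₀ * b₁ + a₀ * D b₁ + D b₁ * a₀ + b₁ * D a₀ = 0 := by
  refine (eq_zero_of_laurent hchar ht
    (v := D a₀ * b₀ + a₀ * D b₀ + D b₀ * a₀ + b₀ * D a₀
      + (D a₁ * b₁ + a₁ * D b₁ + D b₁ * a₁ + b₁ * D a₁)
      - D (a₀ * b₀ + a₁ * b₁ + (b₀ * a₀ + b₁ * a₁)))
    (w := D a₁ * b₀ + a₁ * D b₀ + D b₀ * a₁ + b₀ * D a₁ - D (b₀ * a₁)) ?_).1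
  intro t ht0
  have e := h t ht0
  simp only [JordanLeibniz, map_add, map_smul, mul_add, add_mul, smul_mul_assoc, mul_smul_comm,
    h₀₁, h₁₀, hba, smul_add, smul_zero, smul_smul, inv_mul_cancel₀ ht0, mul_inv_cancel₀ ht0,
    one_smul, add_zero, zero_add, smul_sub] at e ⊢
  rw [← sub_eq_zero] at e
  rw [← neg_eq_zero, ← e]
  abel

namespace TriangularPeirce

variable {𝒜 : Subalgebra 𝔽 B} {P Q : B} {M₁ M M₂ : Submodule 𝔽 B}

section
variable (T : TriangularPeirce 𝒜 P Q M₁ M M₂)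
include T

theorem Q_mul₁ {x : B} (hx : x ∈ M₁) : Q * x = 0 := by
  rw [← T.left₁ x hx, ← mul_assoc, T.mul_QP, zero_mul]

theorem mul_Q₁ {x : B} (hx : x ∈ M₁) : x * Q = 0 := by
  rw [← T.right₁ x hx, mul_assoc, T.mul_PQ, mul_zero]

theorem Q_mul {s : B} (hs : s ∈ M) : Q * s = 0 := by
  rw [← T.left s hs, ← mul_assoc, T.mul_QP, zero_mul]

theorem mul_P {s : B} (hs : s ∈ M) : s * P = 0 := by
  rw [← T.right s hs, mul_assoc, T.mul_QP, mul_zero]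

theorem P_mul₂ {w : B} (hw : w ∈ M₂) : P * w = 0 := by
  rw [← T.left₂ w hw, ← mul_assoc, T.mul_PQ, zero_mul]

theorem mul_P₂ {w : B} (hw : w ∈ M₂) : w * P = 0 := by
  rw [← T.right₂ w hw, mul_assoc, T.mul_QP, mul_zero]

theorem mul_eq_zero₁₂ {x w : B} (hx : x ∈ M₁) (hw : w ∈ M₂) : x * w = 0 := by
  rw [← T.right₁ x hx, mul_assoc, T.P_mul₂ hw, mul_zero]

theorem mul_eq_zero₂₁ {x w : B} (hx : x ∈ M₁) (hw : w ∈ M₂) : w * x = 0 := by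
  rw [← T.right₂ w hw, mul_assoc, T.Q_mul₁ hx, mul_zero]

theorem mul_eq_zero₀₁ {x s : B} (hx : x ∈ M₁) (hs : s ∈ M) : s * x = 0 := by
  rw [← T.right s hs, mul_assoc, T.Q_mul₁ hx, mul_zero]

theorem mul_eq_zero₂₀ {s w : B} (hs : s ∈ M) (hw : w ∈ M₂) : w * s = 0 := by
  rw [← T.right₂ w hw, mul_assoc, T.Q_mul hs, mul_zero]

theorem mul_eq_zero₀₀ {s r : B} (hs : s ∈ M) (hr : r ∈ M) : s * r = 0 := by
  rw [← T.right s hs, mul_assoc, T.Q_mul hr, mul_zero]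

/-- A map Jordan derivable at `C` annihilates the Jordan product of suitable zero-product pairs,
whatever `C` is. -/
theorem jordan_zero_product (hchar : (2 : 𝔽) ≠ 0) (ht : ∃ t : 𝔽, t ≠ 0 ∧ t ≠ 1 ∧ t ≠ -1)
    (D : B →ₗ[𝔽] B) {c₁ c c₂ : B} (hc₁ : c₁ ∈ M₁) (hc : c ∈ M) (hc₂ : c₂ ∈ M₂)
    (hD : ∀ a ∈ 𝒜, ∀ b ∈ 𝒜, a * b = c₁ + c + c₂ → JordanLeibniz D a b)
    {x y s w v : B} (hx : x ∈ M₁) (hy : y ∈ M₁) (hxy : x * y = P) (hs : s ∈ M)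
    (hw : w ∈ M₂) (hv : v ∈ M₂) (hvw : v * w = Q) :
    D (x + s) * (w - y * (s * w)) + (x + s) * D (w - y * (s * w)) + D (w - y * (s * w)) * (x + s)
      + (w - y * (s * w)) * D (x + s) = 0 := by
  have hsw := T.mul₂ s hs w hw
  have hysw := T.mul₁ y hy _ hsw
  have hcv := T.mul₂₂ c₂ hc₂ v hv
  have hyc₁ := T.mul₁₁ y hy c₁ hc₁
  have hyc := T.mul₁ y hy c hc
  have hxysw : x * (y * (s * w)) = s * w := by rw [← mul_assoc, hxy, T.left _ hsw]
  have h₀₁ : (x + s) * (w - y * (s * w)) = 0 := by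
    rw [add_mul, mul_sub, mul_sub, T.mul_eq_zero₁₂ hx hw, hxysw, T.mul_eq_zero₀₀ hs hysw]
    abel
  have h₁₀ : (c₂ * v) * (y * c₁ + y * c) = 0 := by
    rw [mul_add, T.mul_eq_zero₂₁ hyc₁ hcv, T.mul_eq_zero₂₀ hyc hcv, add_zero]
  have hba : (w - y * (s * w)) * (x + s) = 0 := by
    rw [mul_add, sub_mul, sub_mul, T.mul_eq_zero₂₁ hx hw, T.mul_eq_zero₂₀ hs hw,
      T.mul_eq_zero₀₁ hx hysw, T.mul_eq_zero₀₀ hysw hs]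
    abel
  refine jordan_eq_zero_of_scaling hchar ht D (a₁ := c₂ * v) (b₀ := y * c₁ + y * c) h₀₁ h₁₀ hba ?_
  intro t ht0
  refine hD _ ?_ _ ?_ ?_
  · exact 𝒜.add_mem (𝒜.add_mem (T.le₁ _ hx) (T.le _ hs)) (𝒜.smul_mem (T.le₂ _ hcv) _)
  · exact 𝒜.add_mem (𝒜.add_mem (T.le₁ _ hyc₁) (T.le _ hyc))
      (𝒜.smul_mem (𝒜.sub_mem (T.le₂ _ hw) (T.le _ hysw)) _)
  · have e1 : (x + s) * (y * c₁ + y * c) = c₁ + c := by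
      rw [add_mul, mul_add, mul_add, T.mul_eq_zero₀₁ hyc₁ hs, T.mul_eq_zero₀₀ hs hyc,
        ← mul_assoc, ← mul_assoc, hxy, T.left₁ _ hc₁, T.left _ hc]
      abel
    have e2 : (c₂ * v) * (w - y * (s * w)) = c₂ := by
      rw [mul_sub, T.mul_eq_zero₂₀ hysw hcv, mul_assoc, hvw, T.right₂ _ hc₂, sub_zero]
    rw [add_mul, mul_add (x + s), mul_add (t⁻¹ • _), smul_mul_assoc, smul_mul_assoc,
      mul_smul_comm, mul_smul_comm, h₀₁, h₁₀, e1, e2, smul_zero, smul_zero, smul_smul,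
      inv_mul_cancel₀ ht0, one_smul]
    abel

theorem cornerRelations (hchar : (2 : 𝔽) ≠ 0) (ht : ∃ t : 𝔽, t ≠ 0 ∧ t ≠ 1 ∧ t ≠ -1)
    (D : B →ₗ[𝔽] B) {c₁ c c₂ : B} (hc₁ : c₁ ∈ M₁) (hc : c ∈ M) (hc₂ : c₂ ∈ M₂)
    (hD : ∀ a ∈ 𝒜, ∀ b ∈ 𝒜, a * b = c₁ + c + c₂ → JordanLeibniz D a b) :
    CornerRelations M₁ M M₂ D := by
  have key : ∀ x ∈ M₁, ∀ y ∈ M₁, x * y = P → ∀ s ∈ M, ∀ w ∈ M₂, ∀ v ∈ M₂, v * w = Q →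
      (D x * w + w * D x + (x * D w + D w * x) = 0) ∧
      (D s * w + w * D s + (s * D w + D w * s) - (D x * (y * (s * w)) + y * (s * w) * D x
        + (x * D (y * (s * w)) + D (y * (s * w)) * x)) = 0) ∧
      -(D s * (y * (s * w)) + y * (s * w) * D s
        + (s * D (y * (s * w)) + D (y * (s * w)) * s)) = 0 := by
    intro x hx y hy hxy s hs w hw v hv hvw
    refine eq_zero_of_laurent hchar ht ?_
    intro t ht0
    have e := T.jordan_zero_product hchar ht D hc₁ hc hc₂ hD (M₁.smul_mem t hx)
      (M₁.smul_mem t⁻¹ hy)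
      (by rw [smul_mul_assoc, mul_smul_comm, smul_smul, mul_inv_cancel₀ ht0, one_smul, hxy])
      hs hw hv hvw
    simp only [map_add, map_sub, map_smul, mul_add, add_mul, mul_sub, sub_mul, smul_mul_assoc,
      mul_smul_comm, smul_add, smul_sub, smul_neg, smul_smul, inv_mul_cancel₀ ht0,
      mul_inv_cancel₀ ht0, one_smul, neg_add] at e ⊢
    rw [← e]
    abel
  have hPP : P * P = P := T.left₁ P T.memP
  have hQQ : Q * Q = Q := T.left₂ Q T.memQ
  have ind : ∀ f : B →ₗ[𝔽] B →ₗ[𝔽] B,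
      (∀ x ∈ M₁, ∀ y ∈ M₁, x * y = P → y * x = P → ∀ w ∈ M₂, ∀ v ∈ M₂, v * w = Q → f x w = 0) →
      ∀ x ∈ M₁, ∀ w ∈ M₂, f x w = 0 := by
    intro f hf x hx w hw
    have h1 : ∀ a ∈ M₁, ∀ b ∈ M₁, a * b = P → b * a = P → f a w = 0 := by
      intro a ha b hb hab hba
      refine LinearMap.mem_ker.1 ((Submodule.span_le (p := LinearMap.ker (f a))).2 ?_
        (T.span₂ w hw))
      rintro w' ⟨hw', v, hv, -, hvw⟩
      exact hf a ha b hb hab hba w' hw' v hv hvw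
    refine LinearMap.mem_ker.1 ((Submodule.span_le (p := LinearMap.ker (f.flip w))).2 ?_
      (T.span₁ x hx))
    rintro a ⟨ha, b, hb, hab, hba⟩
    exact h1 a ha b hb hab hba
  refine ⟨?_, ?_, ?_⟩
  · refine ind (LinearMap.mk₂ 𝔽 (fun x w => D x * w + w * D x + (x * D w + D w * x))
      ?_ ?_ ?_ ?_) ?_
    · intros
      simp only [map_add, add_mul, mul_add]
      abel
    · intros
      simp only [map_smul, smul_mul_assoc, mul_smul_comm, smul_add]
    · intros
      simp only [map_add, add_mul, mul_add]
      abel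
    · intros
      simp only [map_smul, smul_mul_assoc, mul_smul_comm, smul_add]
    · intro x hx y hy hxy _ w hw v hv hvw
      exact (key x hx y hy hxy 0 M.zero_mem w hw v hv hvw).1
  · intro x hx s hs w hw
    rw [← sub_eq_zero]
    refine ind (LinearMap.mk₂ 𝔽 (fun x w => D (x * s) * w + w * D (x * s)
      + (x * s * D w + D w * (x * s)) - (D x * (s * w) + s * w * D x
        + (x * D (s * w) + D (s * w) * x))) ?_ ?_ ?_ ?_) ?_ x hx w hw
    · intros
      simp only [map_add, add_mul, mul_add]
      abel
    · intros
      simp only [map_smul, smul_mul_assoc, mul_smul_comm, smul_add, smul_sub]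
    · intros
      simp only [map_add, add_mul, mul_add]
      abel
    · intros
      simp only [map_smul, smul_mul_assoc, mul_smul_comm, smul_add, smul_sub]
    · intro x hx y hy hxy hyx w hw v hv hvw
      have e := (key x hx y hy hxy (x * s) (T.mul₁ x hx s hs) w hw v hv hvw).2.1
      rwa [show y * (x * s * w) = s * w by
        rw [mul_assoc x, ← mul_assoc, hyx, T.left _ (T.mul₂ s hs w hw)]] at e
  · intro s hs
    have e := (key P T.memP P T.memP hPP s hs Q T.memQ Q T.memQ hQQ).2.2
    rw [T.right s hs, T.left s hs, neg_eq_zero, add_comm (s * D s) (D s * s), ← two_smul 𝔽] at e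
    exact (smul_eq_zero.1 e).resolve_left hchar

variable (hchar : (2 : 𝔽) ≠ 0) {D : B →ₗ[𝔽] B} (R : CornerRelations M₁ M M₂ D)
include hchar R

theorem map_corner₂ (hp : P * D P * Q = 0) (hq : Q * D P * P = 0) {w : B} (hw : w ∈ M₂) :
    P * D w = 0 ∧ D w * P = 0 := by
  have two : ∀ z : B, z + z = 0 → z = 0 := fun z hz =>
    (smul_eq_zero.1 ((two_smul 𝔽 z).trans hz)).resolve_left hchar
  have e := R.diag P T.memP w hw
  have hPP := T.left₁ P T.memP
  have h1 : P * (D P * w) = 0 := by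
    rw [← T.left₂ w hw, ← mul_assoc, ← mul_assoc, hp, zero_mul]
  have h2 : w * D P * P = 0 := by
    rw [← T.right₂ w hw, mul_assoc, mul_assoc, ← mul_assoc Q, hq, mul_zero]
  have e1 : P * D w + P * D w * P = 0 := by
    have e1 := congrArg (P * ·) e
    simp only [mul_add, h1, ← mul_assoc P w, T.P_mul₂ hw, zero_mul, ← mul_assoc P P, hPP,
      zero_add, mul_zero] at e1
    rwa [mul_assoc]
  have e2 : P * D w * P + D w * P = 0 := by
    have e2 := congrArg (· * P) e
    simpa only [add_mul, h2, mul_assoc _ w, T.mul_P₂ hw, mul_zero, mul_assoc _ P P, hPP,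
      zero_add, zero_mul] using e2
  have e3 : P * D w * P = 0 := by
    refine two _ ?_
    have e3 := congrArg (· * P) e1
    simpa only [add_mul, mul_assoc _ P P, hPP, zero_mul] using e3
  rw [e3] at e1 e2
  exact ⟨by simpa using e1, by simpa using e2⟩

theorem map_corner₁ (hp : P * D P * Q = 0) (hq : Q * D P * P = 0) {x : B} (hx : x ∈ M₁) :
    Q * D x = 0 ∧ D x * Q = 0 := by
  have two : ∀ z : B, z + z = 0 → z = 0 := fun z hz =>
    (smul_eq_zero.1 ((two_smul 𝔽 z).trans hz)).resolve_left hchar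
  have hQQ := T.left₂ Q T.memQ
  obtain ⟨f1, f2⟩ := T.map_corner₂ hchar R hp hq T.memQ
  have e := R.diag x hx Q T.memQ
  have h1 : x * D Q = 0 := by rw [← T.right₁ x hx, mul_assoc, f1, mul_zero]
  have h2 : D Q * x = 0 := by rw [← T.left₁ x hx, ← mul_assoc, f2, zero_mul]
  rw [h1, h2, add_zero, add_zero] at e
  have e3 : Q * D x * Q = 0 := by
    refine two _ ?_
    have e3 := congrArg (Q * · * Q) e
    simpa only [mul_add, add_mul, ← mul_assoc, hQQ, mul_assoc _ Q Q, mul_zero, zero_mul] using e3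
  have e1 := congrArg (Q * ·) e
  have e2 := congrArg (· * Q) e
  simp only [mul_add, ← mul_assoc, hQQ, e3, zero_add, mul_zero] at e1
  simp only [add_mul, mul_assoc _ Q Q, hQQ, e3, add_zero, zero_mul] at e2
  exact ⟨e1, e2⟩

/-- The `(2,1)` block of `D` vanishes on `M`. -/
theorem lower_eq_zero (hp : P * D P * Q = 0) (hq : Q * D P * P = 0) {s : B} (hs : s ∈ M) :
    Q * D s * P = 0 := by
  have hPP := T.left₁ P T.memP
  have hQQ := T.left₂ Q T.memQ
  have sq₁ : ∀ s ∈ M, s * D s * P = 0 := by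
    intro s hs
    have e := congrArg (· * P) (R.square s hs)
    simpa only [add_mul, mul_assoc _ s P, T.mul_P hs, mul_zero, zero_add, zero_mul] using e
  have sq₂ : ∀ s ∈ M, Q * D s * s = 0 := by
    intro s hs
    have e := congrArg (Q * ·) (R.square s hs)
    simpa only [mul_add, ← mul_assoc, T.Q_mul hs, zero_mul, add_zero, mul_zero] using e
  have alt₁ : ∀ s ∈ M, ∀ r ∈ M, s * D r * P = -(r * D s * P) := by
    intro s hs r hr
    have e := sq₁ (s + r) (M.add_mem hs hr)
    simp only [map_add, mul_add, add_mul, sq₁ s hs, sq₁ r hr, zero_add, add_zero] at e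
    rw [eq_neg_iff_add_eq_zero, ← e]
    abel
  have alt₂ : ∀ s ∈ M, ∀ r ∈ M, Q * D s * r = -(Q * D r * s) := by
    intro s hs r hr
    have e := sq₂ (s + r) (M.add_mem hs hr)
    simp only [map_add, mul_add, add_mul, sq₂ s hs, sq₂ r hr, zero_add, add_zero] at e
    rw [eq_neg_iff_add_eq_zero, ← e]
    abel
  have lin₁ : ∀ x ∈ M₁, ∀ s ∈ M, Q * D (x * s) * P = Q * D s * x := by
    intro x hx s hs
    have e := congrArg (Q * · * P) (R.mixed x hx s hs Q T.memQ)
    obtain ⟨f1, f2⟩ := T.map_corner₁ hchar R hp hq hx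
    simpa only [T.right s hs, mul_add, add_mul, ← mul_assoc, hQQ, T.Q_mul₁ hx, T.Q_mul hs, f1,
      mul_assoc _ Q P, mul_assoc _ s P, mul_assoc _ x P, T.right₁ x hx, T.mul_QP, T.mul_P hs,
      zero_mul, mul_zero, add_zero, zero_add] using e
  have lin₂ : ∀ s ∈ M, ∀ w ∈ M₂, Q * D (s * w) * P = w * D s * P := by
    intro s hs w hw
    have e := congrArg (Q * · * P) (R.mixed P T.memP s hs w hw)
    simp only [T.left s hs, mul_add, add_mul, ← mul_assoc, T.mul_QP, T.Q_mul hs,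
      T.left₂ w hw, mul_assoc _ P P, hPP, mul_assoc _ s P, mul_assoc _ w P, T.mul_P₂ hw, T.mul_P hs,
      zero_mul, mul_zero, add_zero, zero_add] at e
    exact e.symm
  have mQ : ∀ s ∈ M, ∀ z, s * (Q * z) = s * z := fun s hs z => by
    rw [← mul_assoc, T.right s hs]
  have mP : ∀ s ∈ M, ∀ z, z * P * s = z * s := fun s hs z => by
    rw [mul_assoc, T.left s hs]
  have main : ∀ s ∈ M, ∀ r ∈ M, s * D r * P = 0 := by
    intro s hs r hr
    have hZ : ∃ k : 𝔽, s * D r * P + Q * D s * r = k • (1 : B) := by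
      refine T.center _ ?_ ?_ ?_
      · intro x hx
        have hxr := T.mul₁ x hx r hr
        have e1 : x * (s * D r * P) = -(x * r * D s * P) := by
          rw [alt₁ s hs r hr, mul_neg]
          simp only [mul_assoc]
        have e2 : s * D r * P * x = -(x * r * D s * P) := by
          rw [mul_assoc _ P x, T.left₁ x hx, mul_assoc, ← mQ s hs, ← mul_assoc Q, ← lin₁ x hx r hr,
            mul_assoc Q, mQ s hs, ← mul_assoc, alt₁ s hs _ hxr]
        have e3 : x * (Q * D s * r) = 0 := by
          rw [← mul_assoc, ← mul_assoc, T.mul_Q₁ hx, zero_mul, zero_mul]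
        rw [mul_add, add_mul, e1, e2, e3, mul_assoc _ r x, T.mul_eq_zero₀₁ hx hr, mul_zero]
      · intro t ht
        have e1 : t * (Q * D s * r) = s * D r * t := by
          rw [mul_assoc, mQ t ht, ← mul_assoc, ← mP r hr, alt₁ t ht s hs, neg_mul, mP r hr,
            mul_assoc, ← mQ s hs, ← mul_assoc Q, alt₂ t ht r hr, mul_neg, neg_neg, mul_assoc,
            mQ s hs, mul_assoc]
        have e2 : t * (s * D r * P) = 0 := by
          rw [← mul_assoc, ← mul_assoc, T.mul_eq_zero₀₀ ht hs, zero_mul, zero_mul]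
        rw [mul_add, add_mul, e1, e2, mul_assoc _ r t, T.mul_eq_zero₀₀ hr ht, mul_zero, zero_add,
          add_zero, mP t ht]
      · intro w hw
        have hrw := T.mul₂ r hr w hw
        have wQ : ∀ z, w * (Q * z) = w * z := fun z => by rw [← mul_assoc, T.right₂ w hw]
        have e1 : w * (Q * D s * r) = -(w * D r * s) := by
          rw [alt₂ s hs r hr, mul_neg, mul_assoc, wQ, mul_assoc]
        have e2 : Q * D s * r * w = -(w * D r * s) := by
          rw [mul_assoc, alt₂ s hs _ hrw, ← mP s hs (Q * _), lin₂ r hr w hw, mP s hs]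
        have e3 : w * (s * D r * P) = 0 := by
          rw [← mul_assoc, ← mul_assoc, T.mul_eq_zero₂₀ hs hw, zero_mul, zero_mul]
        rw [mul_add, add_mul, e1, e2, e3, mul_assoc _ P w, T.P_mul₂ hw, mul_zero]
    obtain ⟨k, hk⟩ := hZ
    have h1 : P * (s * D r * P + Q * D s * r) = s * D r * P := by
      simp only [mul_add, ← mul_assoc, T.left s hs, T.mul_PQ, zero_mul, add_zero]
    have h2 : (s * D r * P + Q * D s * r) * s = 0 := by
      rw [add_mul, mul_assoc _ r s, T.mul_eq_zero₀₀ hr hs, mul_zero, add_zero, mP s hs, mul_assoc,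
        ← mQ s hs, ← mul_assoc Q, alt₂ r hr s hs, mul_neg, mul_assoc, mQ s hs, ← mul_assoc,
        ← mP r hr, sq₁ s hs, zero_mul, neg_zero]
    rw [hk] at h1 h2
    rw [smul_mul_assoc, one_mul] at h2
    rcases smul_eq_zero.1 h2 with h | h
    · rw [← h1, h, zero_smul, mul_zero]
    · rw [h, zero_mul, zero_mul]
  rw [mul_assoc]
  refine T.faithful_right _ fun r hr => ?_
  rw [← mul_assoc, main r hr s hs]

theorem map_corner (hp : P * D P * Q = 0) (hq : Q * D P * P = 0) {s : B} (hs : s ∈ M) :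
    Q * D s = 0 ∧ D s * P = 0 ∧ s * D Q = D P * s := by
  have two : ∀ z : B, z + z = 0 → z = 0 := fun z hz =>
    (smul_eq_zero.1 ((two_smul 𝔽 z).trans hz)).resolve_left hchar
  have hPP := T.left₁ P T.memP
  have hQQ := T.left₂ Q T.memQ
  have hl := T.lower_eq_zero hchar R hp hq hs
  obtain ⟨f1, f2⟩ := T.map_corner₁ hchar R hp hq T.memP
  obtain ⟨g1, g2⟩ := T.map_corner₂ hchar R hp hq T.memQ
  have hsP : s * D P = 0 := by rw [← T.right s hs, mul_assoc, f1, mul_zero]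
  have hQs : D Q * s = 0 := by rw [← T.left s hs, ← mul_assoc, g2, zero_mul]
  have e := R.mixed P T.memP s hs Q T.memQ
  rw [T.left s hs, T.right s hs, hsP, hQs, add_zero, add_zero] at e
  have e11 : P * D s * P = 0 := by
    refine two _ ?_
    have e' := congrArg (P * · * P) e
    simp only [mul_add, add_mul, ← mul_assoc, hPP, T.mul_PQ, T.left s hs, mul_assoc _ Q P,
      T.mul_QP, mul_assoc _ P P, mul_assoc _ s P, T.mul_P hs, mul_assoc s (D Q) P, g2,
      zero_mul, mul_zero, add_zero, zero_add] at e'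
    exact e'.symm
  have e22 : Q * D s * Q = 0 := by
    refine two _ ?_
    have e' := congrArg (Q * · * Q) e
    simpa only [mul_add, add_mul, ← mul_assoc, hQQ, T.mul_QP, T.Q_mul hs, mul_assoc _ P Q,
      T.mul_PQ, mul_assoc _ Q Q, f1, zero_mul, mul_zero, add_zero, zero_add] using e'
  have h1 : Q * D s = 0 := by
    rw [← mul_one (Q * D s), ← T.add_eq_one, mul_add, hl, e22, add_zero]
  have h2 : D s * P = 0 := by
    rw [← one_mul (D s * P), ← T.add_eq_one, add_mul, ← mul_assoc, ← mul_assoc, hl, e11, add_zero]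
  have h3 : D s * Q = P * D s := by
    have h3 : D s * P + D s * Q = P * D s + Q * D s := by
      rw [← mul_add, ← add_mul, T.add_eq_one, mul_one, one_mul]
    rwa [h1, h2, zero_add, add_zero] at h3
  rw [h1, h2, h3, add_zero, add_comm] at e
  exact ⟨h1, h2, add_right_cancel e⟩

theorem map_one_scalar (hp : P * D P * Q = 0) (hq : Q * D P * P = 0) :
    ∃ k : 𝔽, D P + D Q = k • (1 : B) := by
  obtain ⟨f1, f2⟩ := T.map_corner₁ hchar R hp hq T.memP
  obtain ⟨g1, g2⟩ := T.map_corner₂ hchar R hp hq T.memQ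
  have hs' : ∀ s ∈ M, s * D Q = D P * s := fun s hs => (T.map_corner hchar R hp hq hs).2.2
  have fP : D P * P = D P := by
    rw [← mul_one (D P), ← T.add_eq_one, mul_add, f2, add_zero, mul_assoc, T.left₁ P T.memP]
  have gQ : Q * D Q = D Q := by
    rw [← one_mul (D Q), ← T.add_eq_one, add_mul, g1, zero_add, ← mul_assoc, T.left₂ Q T.memQ]
  refine T.center _ ?_ ?_ ?_
  · intro x hx
    have h1 : x * D Q = 0 := by rw [← T.right₁ x hx, mul_assoc, g1, mul_zero]
    have h2 : D Q * x = 0 := by rw [← T.left₁ x hx, ← mul_assoc, g2, zero_mul]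
    have h3 : (x * D P - D P * x) * P = 0 := by
      refine T.faithful_left _ fun s hs => ?_
      rw [sub_mul, mul_assoc, ← hs' s hs, mul_assoc (D P), ← hs' _ (T.mul₁ x hx s hs), mul_assoc,
        sub_self]
    rw [sub_mul, mul_assoc, fP, mul_assoc, T.right₁ x hx] at h3
    rw [mul_add, add_mul, h1, h2, sub_eq_zero.1 h3]
  · intro s hs
    have h1 : s * D P = 0 := by rw [← T.right s hs, mul_assoc, f1, mul_zero]
    have h2 : D Q * s = 0 := by rw [← T.left s hs, ← mul_assoc, g2, zero_mul]
    rw [mul_add, add_mul, h1, h2, hs' s hs, zero_add, add_zero]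
  · intro w hw
    have h1 : w * D P = 0 := by rw [← T.right₂ w hw, mul_assoc, f1, mul_zero]
    have h2 : D P * w = 0 := by rw [← T.left₂ w hw, ← mul_assoc, f2, zero_mul]
    have h3 : Q * (w * D Q - D Q * w) = 0 := by
      refine T.faithful_right _ fun s hs => ?_
      rw [mul_sub, ← mul_assoc, ← mul_assoc, hs' s hs, hs' _ (T.mul₂ s hs w hw), mul_assoc,
        sub_self]
    rw [mul_sub, ← mul_assoc, ← mul_assoc, gQ, T.left₂ w hw] at h3
    rw [mul_add, add_mul, h1, h2, sub_eq_zero.1 h3]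

theorem leibniz_of_normalized (hP : D P = 0) (hQ : D Q = 0) {x s w y r v : B}
    (hx : x ∈ M₁) (hs : s ∈ M) (hw : w ∈ M₂) (hy : y ∈ M₁) (hr : r ∈ M) (hv : v ∈ M₂) :
    D ((x + s + w) * (y + r + v)) =
      D (x + s + w) * (y + r + v) + (x + s + w) * D (y + r + v) := by
  have hp : P * D P * Q = 0 := by rw [hP, mul_zero, zero_mul]
  have hq : Q * D P * P = 0 := by rw [hP, mul_zero, zero_mul]
  have c₁ : ∀ x ∈ M₁, Q * D x = 0 ∧ D x * Q = 0 := fun x hx => T.map_corner₁ hchar R hp hq hx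
  have c₂ : ∀ w ∈ M₂, P * D w = 0 ∧ D w * P = 0 := fun w hw => T.map_corner₂ hchar R hp hq hw
  have c : ∀ s ∈ M, Q * D s = 0 ∧ D s * P = 0 := fun s hs =>
    ⟨(T.map_corner hchar R hp hq hs).1, (T.map_corner hchar R hp hq hs).2.1⟩
  have aux : ∀ a e b : B, a * e = a → e * b = 0 → a * b = 0 := fun a e b h1 h2 => by
    rw [← h1, mul_assoc, h2, mul_zero]
  have aux' : ∀ a e b : B, e * b = b → a * e = 0 → a * b = 0 := fun a e b h1 h2 => by
    rw [← h1, ← mul_assoc, h2, zero_mul]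
  have mixed : ∀ x ∈ M₁, ∀ s ∈ M, ∀ w ∈ M₂,
      D (x * s) * w + x * s * D w = D x * (s * w) + x * D (s * w) := by
    intro x hx s hs w hw
    have hxs := T.mul₁ x hx s hs
    have hsw := T.mul₂ s hs w hw
    have e := R.mixed x hx s hs w hw
    rwa [aux w Q _ (T.right₂ w hw) (c _ hxs).1, aux' _ P _ (T.left _ hxs) (c₂ w hw).2,
      aux _ Q _ (T.right _ hsw) (c₁ x hx).1, aux' _ P _ (T.left₁ _ hx) (c _ hsw).2,
      add_zero, add_zero, add_zero, add_zero] at e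
  have hxs : ∀ x ∈ M₁, ∀ s ∈ M, D (x * s) = D x * s + x * D s := by
    intro x hx s hs
    have hxs := T.mul₁ x hx s hs
    have e := mixed x hx s hs Q T.memQ
    rwa [hQ, mul_zero, add_zero, T.right s hs, ← add_zero (D (x * s) * Q), ← (c _ hxs).2,
      add_comm, ← mul_add, T.add_eq_one, mul_one] at e
  have hsw : ∀ s ∈ M, ∀ w ∈ M₂, D (s * w) = D s * w + s * D w := by
    intro s hs w hw
    have hsw := T.mul₂ s hs w hw
    have e := mixed P T.memP s hs w hw
    rw [hP, zero_mul, zero_add, T.left s hs, ← add_zero (P * D (s * w)), ← (c _ hsw).1,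
      ← add_mul, T.add_eq_one, one_mul] at e
    exact e.symm
  have hxy : D (x * y) = D x * y + x * D y := by
    have h : (D (x * y) - (D x * y + x * D y)) * P = 0 := by
      refine T.faithful_left _ fun s hs => ?_
      have hys := T.mul₁ y hy s hs
      have e1 := hxs _ (T.mul₁₁ x hx y hy) s hs
      rw [mul_assoc, hxs x hx _ hys, hxs y hy s hs, mul_add, mul_assoc x y] at e1
      have e2 : D (x * y) * s = D x * (y * s) + x * (D y * s) := by
        rw [← add_assoc] at e1
        exact (add_right_cancel e1).symm
      rw [sub_mul, e2, add_mul, mul_assoc, mul_assoc, sub_self]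
    have h' : (D (x * y) - (D x * y + x * D y)) * Q = 0 := by
      rw [sub_mul, add_mul, (c₁ _ (T.mul₁₁ x hx y hy)).2, mul_assoc, mul_assoc, T.mul_Q₁ hy,
        (c₁ y hy).2, mul_zero, mul_zero, add_zero, sub_zero]
    rw [← sub_eq_zero, ← mul_one (_ - _), ← T.add_eq_one, mul_add, h, h', add_zero]
  have hwv : D (w * v) = D w * v + w * D v := by
    have h : Q * (D (w * v) - (D w * v + w * D v)) = 0 := by
      refine T.faithful_right _ fun s hs => ?_
      have e1 := hsw s hs _ (T.mul₂₂ w hw v hv)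
      rw [← mul_assoc, hsw _ (T.mul₂ s hs w hw) v hv, hsw s hs w hw, add_mul, mul_assoc (D s),
        add_assoc] at e1
      have e2 := add_left_cancel e1
      rw [mul_sub, ← e2, mul_add, ← mul_assoc, ← mul_assoc, sub_self]
    have h' : P * (D (w * v) - (D w * v + w * D v)) = 0 := by
      rw [mul_sub, mul_add, (c₂ _ (T.mul₂₂ w hw v hv)).1, ← mul_assoc, ← mul_assoc, T.P_mul₂ hw,
        (c₂ w hw).1, zero_mul, zero_mul, add_zero, sub_zero]
    rw [← sub_eq_zero, ← one_mul (_ - _), ← T.add_eq_one, add_mul, h, h', add_zero]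
  simp only [mul_add, add_mul, map_add, hxy, hwv, hxs x hx r hr, hsw s hs v hv,
    T.mul_eq_zero₁₂ hx hv, T.mul_eq_zero₀₁ hy hs, T.mul_eq_zero₀₀ hs hr, T.mul_eq_zero₂₁ hy hw,
    T.mul_eq_zero₂₀ hr hw, map_zero,
    aux' _ Q _ (T.left₂ v hv) (c₁ x hx).2, aux _ P _ (T.right₁ x hx) (c₂ v hv).1,
    aux' _ P _ (T.left₁ y hy) (c s hs).2, aux _ Q _ (T.right s hs) (c₁ y hy).1,
    aux' _ P _ (T.left r hr) (c s hs).2, aux _ Q _ (T.right s hs) (c r hr).1,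
    aux' _ P _ (T.left₁ y hy) (c₂ w hw).2, aux _ Q _ (T.right₂ w hw) (c₁ y hy).1,
    aux' _ P _ (T.left r hr) (c₂ w hw).2, aux _ Q _ (T.right₂ w hw) (c r hr).1]
  abel

theorem sub_of_jordan (E : B →ₗ[𝔽] B) (hE : ∀ a b, JordanLeibniz E a b) :
    CornerRelations M₁ M M₂ (D - E) := by
  have hE' : ∀ a b, E a * b + b * E a + (a * E b + E b * a) = E (a * b + b * a) := fun a b => by
    rw [hE a b]; abel
  refine ⟨?_, ?_, ?_⟩
  · intro x hx w hw
    have e := hE' x w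
    rw [T.mul_eq_zero₁₂ hx hw, T.mul_eq_zero₂₁ hx hw, add_zero, map_zero] at e
    have e' := congrArg₂ (· - ·) (R.diag x hx w hw) e
    simp only [LinearMap.sub_apply, sub_mul, mul_sub, sub_zero] at e' ⊢
    rw [← e']
    abel
  · intro x hx s hs w hw
    have hxs := T.mul₁ x hx s hs
    have hsw := T.mul₂ s hs w hw
    have e1 := hE' (x * s) w
    have e2 := hE' x (s * w)
    rw [T.mul_eq_zero₂₀ hxs hw, mul_assoc x s w] at e1
    rw [T.mul_eq_zero₀₁ hx hsw, ← e1] at e2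
    have e := congrArg₂ (· - ·) (R.mixed x hx s hs w hw) e2.symm
    simp only [LinearMap.sub_apply, sub_mul, mul_sub] at e ⊢
    rw [← sub_eq_zero] at e ⊢
    rw [← e]
    abel
  · intro s hs
    have e := hE' s s
    rw [T.mul_eq_zero₀₀ hs hs, add_zero, map_zero, add_comm (s * E s), ← two_smul 𝔽] at e
    have e' := (smul_eq_zero.1 e).resolve_left hchar
    rw [LinearMap.sub_apply, sub_mul, mul_sub, sub_add_sub_comm, R.square s hs, e', sub_zero]

omit hchar in
theorem sub_smul_id (k : 𝔽) :
    CornerRelations M₁ M M₂ (D - k • LinearMap.id) := by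
  refine ⟨?_, ?_, ?_⟩
  · intro x hx w hw
    have e := R.diag x hx w hw
    simp only [LinearMap.sub_apply, LinearMap.smul_apply, LinearMap.id_apply, sub_mul, mul_sub,
      smul_mul_assoc, mul_smul_comm, T.mul_eq_zero₁₂ hx hw, T.mul_eq_zero₂₁ hx hw, smul_zero,
      sub_zero]
    exact e
  · intro x hx s hs w hw
    have e := R.mixed x hx s hs w hw
    rw [← sub_eq_zero] at e ⊢
    simp only [LinearMap.sub_apply, LinearMap.smul_apply, LinearMap.id_apply, sub_mul, mul_sub,
      smul_mul_assoc, mul_smul_comm, T.mul_eq_zero₂₀ (T.mul₁ x hx s hs) hw,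
      T.mul_eq_zero₀₁ hx (T.mul₂ s hs w hw), smul_zero, mul_assoc x s] at e ⊢
    rw [← e]
    abel
  · intro s hs
    have e := R.square s hs
    simp only [LinearMap.sub_apply, LinearMap.smul_apply, LinearMap.id_apply, sub_mul, mul_sub,
      smul_mul_assoc, mul_smul_comm, T.mul_eq_zero₀₀ hs hs, smul_zero, sub_zero]
    exact e

/-- On the triangular part, `D` is a scalar multiple of the identity plus a derivation. -/
theorem exists_derivation : ∃ (k : 𝔽) (d : B →ₗ[𝔽] B), (∀ a, D a = d a + k • a) ∧
    ∀ x ∈ M₁, ∀ s ∈ M, ∀ w ∈ M₂, ∀ y ∈ M₁, ∀ r ∈ M, ∀ v ∈ M₂,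
      d ((x + s + w) * (y + r + v)) =
        d (x + s + w) * (y + r + v) + (x + s + w) * d (y + r + v) := by
  have hPP := T.left₁ P T.memP
  have hQQ := T.left₂ Q T.memQ
  set m : B := P * D P * Q - Q * D P * P with hm
  set E : B →ₗ[𝔽] B := LinearMap.mulRight 𝔽 m - LinearMap.mulLeft 𝔽 m with hE
  have hEa : ∀ a, E a = a * m - m * a := fun a => by simp [hE]
  have hEleib : ∀ a b, E (a * b) = E a * b + a * E b := fun a b => by
    rw [hEa, hEa, hEa]
    noncomm_ring
  have hEJ : ∀ a b, JordanLeibniz E a b := fun a b => by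
    rw [JordanLeibniz, map_add, hEleib, hEleib]
    abel
  have R₁ := T.sub_of_jordan hchar R E hEJ
  have hEP : E P = P * D P * Q + Q * D P * P := by
    rw [hEa, hm, mul_sub, sub_mul, ← mul_assoc, ← mul_assoc, ← mul_assoc, ← mul_assoc, hPP,
      T.mul_PQ, mul_assoc _ Q P, T.mul_QP, mul_assoc _ P P, hPP]
    simp
  have hp : P * (D - E) P * Q = 0 := by
    rw [LinearMap.sub_apply, hEP, mul_sub, mul_add, sub_mul, add_mul]
    simp only [← mul_assoc, hPP, T.mul_PQ, mul_assoc _ Q Q, hQQ, zero_mul, add_zero, sub_self]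
  have hq : Q * (D - E) P * P = 0 := by
    rw [LinearMap.sub_apply, hEP, mul_sub, mul_add, sub_mul, add_mul]
    simp only [← mul_assoc, hQQ, T.mul_QP, mul_assoc _ P P, hPP, zero_mul, zero_add, sub_self]
  obtain ⟨k, hk⟩ := T.map_one_scalar hchar R₁ hp hq
  have R₂ := T.sub_smul_id R₁ k
  have hP : (D - E - k • LinearMap.id : B →ₗ[𝔽] B) P = 0 := by
    have e := congrArg (· * P) hk
    have f2 := (T.map_corner₁ hchar R₁ hp hq T.memP).2
    have g2 := (T.map_corner₂ hchar R₁ hp hq T.memQ).2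
    simp only [add_mul, g2, add_zero, smul_mul_assoc, one_mul] at e
    rw [LinearMap.sub_apply _ (k • _), LinearMap.smul_apply, LinearMap.id_apply, ← e,
      ← add_zero ((D - E) P * P), ← f2, ← mul_add, T.add_eq_one, mul_one, sub_self, f2]
  have hQ : (D - E - k • LinearMap.id : B →ₗ[𝔽] B) Q = 0 := by
    rw [LinearMap.sub_apply, sub_eq_zero] at hP ⊢
    rw [hP, ← T.add_eq_one, smul_add] at hk
    exact add_left_cancel hk
  refine ⟨k, D - k • LinearMap.id, fun a => by simp, ?_⟩
  intro x hx s hs w hw y hy r hr v hv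
  have e := T.leibniz_of_normalized hchar R₂ hP hQ hx hs hw hy hr hv
  have e' := congrArg₂ (· + ·) e (hEleib (x + s + w) (y + r + v))
  have hd : ∀ a, (D - k • LinearMap.id : B →ₗ[𝔽] B) a =
      (D - E - k • LinearMap.id : B →ₗ[𝔽] B) a + E a := fun a => by
    simp only [LinearMap.sub_apply]
    abel
  simp only [← hd] at e'
  rw [hd (x + s + w), hd (y + r + v), e', add_mul _ _ (y + r + v), mul_add (x + s + w)]
  exact add_add_add_comm _ _ _ _

end

theorem leibniz_of_jordanLeibniz_at (T : TriangularPeirce 𝒜 P Q M₁ M M₂) (hP0 : P ≠ 0)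
    (hchar : (2 : 𝔽) ≠ 0) (ht : ∃ t : 𝔽, t ≠ 0 ∧ t ≠ 1 ∧ t ≠ -1)
    (D : B →ₗ[𝔽] B) {c₁ c c₂ : B} (hc₁ : c₁ ∈ M₁) (hc : c ∈ M) (hc₂ : c₂ ∈ M₂)
    (hD : ∀ a ∈ 𝒜, ∀ b ∈ 𝒜, a * b = c₁ + c + c₂ → JordanLeibniz D a b) :
    ∀ x ∈ M₁, ∀ s ∈ M, ∀ w ∈ M₂, ∀ y ∈ M₁, ∀ r ∈ M, ∀ v ∈ M₂,
      D ((x + s + w) * (y + r + v)) =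
        D (x + s + w) * (y + r + v) + (x + s + w) * D (y + r + v) := by
  obtain ⟨k, d, hk, hd⟩ := T.exists_derivation hchar
    (T.cornerRelations hchar ht D hc₁ hc hc₂ hD)
  suffices k = 0 by
    subst this
    simpa only [hk, zero_smul, add_zero] using hd
  by_contra hk0
  have key : ∀ x ∈ M₁, ∀ s ∈ M, ∀ w ∈ M₂, ∀ y ∈ M₁, ∀ r ∈ M, ∀ v ∈ M₂,
      (x + s + w) * (y + r + v) = c₁ + c + c₂ →
      (x + s + w) * (y + r + v) + (y + r + v) * (x + s + w) = 0 := by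
    intro x hx s hs w hw y hy r hr v hv h
    have e := hD _ (𝒜.add_mem (𝒜.add_mem (T.le₁ x hx) (T.le s hs)) (T.le₂ w hw)) _
      (𝒜.add_mem (𝒜.add_mem (T.le₁ y hy) (T.le r hr)) (T.le₂ v hv)) h
    have e1 := hd x hx s hs w hw y hy r hr v hv
    have e2 := hd y hy r hr v hv x hx s hs w hw
    generalize x + s + w = a at e e1 e2 ⊢
    generalize y + r + v = b at e e1 e2 ⊢
    rw [JordanLeibniz, hk, hk a, hk b, map_add, e1, e2] at e
    simp only [add_mul, mul_add, smul_mul_assoc, mul_smul_comm] at e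
    rw [← sub_eq_zero] at e
    refine (smul_eq_zero.1 (?_ : k • (a * b + b * a) = 0)).resolve_left hk0
    rw [← neg_eq_zero, ← e, smul_add]
    abel
  have hc0 : c₁ + c + c₂ = 0 := by
    have e := key P T.memP 0 M.zero_mem Q T.memQ c₁ hc₁ c hc c₂ hc₂
    rw [add_zero, T.add_eq_one, one_mul, mul_one, ← two_smul 𝔽] at e
    exact (smul_eq_zero.1 (e rfl)).resolve_left hchar
  refine hP0 ?_
  rw [← T.left₁ P T.memP]
  refine T.faithful_left P fun s hs => ?_
  have e := key 0 M₁.zero_mem 0 M.zero_mem Q T.memQ 0 M₁.zero_mem s hs 0 M₂.zero_mem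
  simp only [zero_add, add_zero, T.Q_mul hs, T.right s hs, hc0, true_implies] at e
  rw [e, mul_zero]

end TriangularPeirce
end Jordan

section Corner

variable {𝔽 B : Type*} [Field 𝔽] [Ring B] [Algebra 𝔽 B] {𝒜 : Subalgebra 𝔽 B}

/-- The corner `e𝒜f`, as a subspace of the ambient algebra. -/
def corner (e f : 𝒜) : Submodule 𝔽 B :=
  LinearMap.range (𝒜.val.toLinearMap ∘ₗ LinearMap.mulRight 𝔽 f ∘ₗ LinearMap.mulLeft 𝔽 e)

theorem mem_corner {e f : 𝒜} {x : B} : x ∈ corner e f ↔ ∃ a : 𝒜, ((e * a * f : 𝒜) : B) = x :=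
  Iff.rfl

theorem mul_mem_corner {e f g : 𝒜} {x y : B} (hx : x ∈ corner e f) (hy : y ∈ corner f g) :
    x * y ∈ corner e g := by
  obtain ⟨a, rfl⟩ := mem_corner.1 hx
  obtain ⟨b, rfl⟩ := mem_corner.1 hy
  refine mem_corner.2 ⟨a * f * (f * b), ?_⟩
  rw [← MulMemClass.coe_mul]
  simp only [mul_assoc]

theorem left_mul_corner {e f : 𝒜} (he : e * e = e) {x : B} (hx : x ∈ corner e f) :
    (e : B) * x = x := by
  obtain ⟨a, rfl⟩ := mem_corner.1 hx
  rw [← MulMemClass.coe_mul, ← mul_assoc, ← mul_assoc, he]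

theorem corner_mul_right {e f : 𝒜} (hf : f * f = f) {x : B} (hx : x ∈ corner e f) :
    x * (f : B) = x := by
  obtain ⟨a, rfl⟩ := mem_corner.1 hx
  rw [← MulMemClass.coe_mul, mul_assoc, hf]

theorem corner_mem {e f : 𝒜} {x : B} (hx : x ∈ corner e f) : x ∈ 𝒜 := by
  obtain ⟨a, rfl⟩ := mem_corner.1 hx
  exact SetLike.coe_mem _

theorem self_mem_corner {e : 𝒜} (he : e * e = e) : (e : B) ∈ corner e e :=
  mem_corner.2 ⟨e, by rw [he, he]⟩

theorem mem_span_units_corner {e : 𝒜}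
    (h : ∀ a : 𝒜, e * a * e ∈ Submodule.span 𝔽
      {x : 𝒜 | x = e * x * e ∧ ∃ y, y = e * y * e ∧ x * y = e ∧ y * x = e})
    {x : B} (hx : x ∈ corner e e) :
    x ∈ Submodule.span 𝔽 {x : B | x ∈ corner e e ∧
      ∃ y ∈ corner e e, x * y = (e : B) ∧ y * x = (e : B)} := by
  obtain ⟨a, rfl⟩ := mem_corner.1 hx
  have hm := Submodule.mem_map_of_mem (f := 𝒜.val.toLinearMap) (h a)
  rw [Submodule.map_span] at hm
  refine Submodule.span_mono ?_ hm
  rintro _ ⟨z, ⟨hz, y, hy, hzy, hyz⟩, rfl⟩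
  refine ⟨mem_corner.2 ⟨z, congrArg _ hz.symm⟩, y, mem_corner.2 ⟨y, congrArg _ hy.symm⟩, ?_, ?_⟩
  · exact congrArg Subtype.val hzy
  · exact congrArg Subtype.val hyz

theorem eq_add_corners {P Q a : 𝒜} (hQ : Q = 1 - P) (ha : Q * a * P = 0) :
    (a : B) = ((P * a * P : 𝒜) : B) + ((P * a * Q : 𝒜) : B) + ((Q * a * Q : 𝒜) : B) := by
  have h : a = P * a * P + P * a * Q + Q * a * Q := by
    calc a = P * a * P + P * a * (1 - P) + (1 - P) * a * P + (1 - P) * a * (1 - P) := by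
          noncomm_ring
      _ = _ := by rw [← hQ, ha, add_zero]
  exact congrArg Subtype.val h

end Corner


/-- if `𝒜₁₂` is faithful to `ℬ` and `C(T_𝒜, ℬ) = 𝔽I`, and the linear map
`δ : 𝒜 → ℬ` is Jordan derivable at some `C ∈ T_𝒜`, then `δ` restricted to
`T_𝒜 = {A ∈ 𝒜 : QAP = 0}` is a derivation from `T_𝒜` to `ℬ`. -/
theorem statement4 {𝔽 B : Type*} [Field 𝔽] [Ring B] [Algebra 𝔽 B]
    -- the field has characteristic ≠ 2 and at least 4 elements
    (hchar : (2 : 𝔽) ≠ 0) (hcard : 4 ≤ Cardinal.mk 𝔽)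
    -- `𝒜` is a unital subalgebra of `ℬ` (same identity)
    (𝒜 : Subalgebra 𝔽 B)
    -- `P ∈ 𝒜` is a nontrivial idempotent; `Q = 1 - P`
    (P Q : 𝒜) (hP : P * P = P) (hP0 : P ≠ 0) (hP1 : P ≠ 1) (hQ : Q = 1 - P)
    -- every element of `𝒜₁₁` is a linear combination of elements invertible in `𝒜₁₁`
    (hinv₁ : ∀ a : 𝒜, P * a * P ∈ Submodule.span 𝔽
      {x : 𝒜 | x = P * x * P ∧ ∃ y, y = P * y * P ∧ x * y = P ∧ y * x = P})
    -- every element of `𝒜₂₂` is a linear combination of elements invertible in `𝒜₂₂`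
    (hinv₂ : ∀ a : 𝒜, Q * a * Q ∈ Submodule.span 𝔽
      {x : 𝒜 | x = Q * x * Q ∧ ∃ y, y = Q * y * Q ∧ x * y = Q ∧ y * x = Q})
    -- `𝒜₁₂` is faithful to `ℬ`
    (hlf : ∀ N : B, (∀ a : 𝒜, N * ((P * a * Q : 𝒜) : B) = 0) → N * (P : B) = 0)
    (hrf : ∀ N : B, (∀ a : 𝒜, ((P * a * Q : 𝒜) : B) * N = 0) → (Q : B) * N = 0)
    -- `C(T_𝒜, ℬ) = 𝔽I`, where `T_𝒜 = {A ∈ 𝒜 : QAP = 0}`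
    (hcenter : ∀ N : B, (∀ a : 𝒜, Q * a * P = 0 → (a : B) * N = N * (a : B)) →
      ∃ k : 𝔽, N = k • (1 : B))
    -- `δ` is Jordan derivable at `C ∈ T_𝒜`
    (C : 𝒜) (hC : Q * C * P = 0)
    (δ : 𝒜 →ₗ[𝔽] B)
    (hδ : ∀ a b : 𝒜, a * b = C →
      δ (a * b + b * a) = δ a * (b : B) + (a : B) * δ b + δ b * (a : B) + (b : B) * δ a) :
    -- `δ|_{T_𝒜}` is a derivation from `T_𝒜` to `ℬ`
    ∀ a b : 𝒜, Q * a * P = 0 → Q * b * P = 0 →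
      δ (a * b) = δ a * (b : B) + (a : B) * δ b := by
  have ht := exists_ne_zero_one_neg_one hcard
  have hQQ : Q * Q = Q := by
    rw [hQ, mul_sub, sub_mul, sub_mul, hP]
    simp
  have hPQ : P * Q = 0 := by rw [hQ, mul_sub, hP, mul_one, sub_self]
  have hQP : Q * P = 0 := by rw [hQ, sub_mul, hP, one_mul, sub_self]
  have mk : ∀ e f a : 𝒜, ((e * a * f : 𝒜) : B) ∈ corner e f := fun e f a => mem_corner.2 ⟨a, rfl⟩
  have T : TriangularPeirce 𝒜 (P : B) (Q : B) (corner P P) (corner P Q) (corner Q Q) :=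
    { add_eq_one := congrArg Subtype.val (show P + Q = 1 by rw [hQ]; abel)
      mul_PQ := congrArg Subtype.val hPQ
      mul_QP := congrArg Subtype.val hQP
      memP := self_mem_corner hP
      memQ := self_mem_corner hQQ
      le₁ := fun _ => corner_mem
      le := fun _ => corner_mem
      le₂ := fun _ => corner_mem
      left₁ := fun _ => left_mul_corner hP
      right₁ := fun _ => corner_mul_right hP
      left := fun _ => left_mul_corner hP
      right := fun _ => corner_mul_right hQQ
      left₂ := fun _ => left_mul_corner hQQ
      right₂ := fun _ => corner_mul_right hQQ
      mul₁₁ := fun _ hx _ hy => mul_mem_corner hx hy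
      mul₁ := fun _ hx _ hy => mul_mem_corner hx hy
      mul₂ := fun _ hx _ hy => mul_mem_corner hx hy
      mul₂₂ := fun _ hx _ hy => mul_mem_corner hx hy
      faithful_left := fun n hn => hlf n fun a => hn _ (mk P Q a)
      faithful_right := fun n hn => hrf n fun a => hn _ (mk P Q a)
      span₁ := fun _ hx => mem_span_units_corner hinv₁ hx
      span₂ := fun _ hx => mem_span_units_corner hinv₂ hx
      center := fun n h₁ h h₂ => hcenter n fun a ha => by
        rw [eq_add_corners hQ ha, add_mul, add_mul, mul_add, mul_add, h₁ _ (mk P P a),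
          h _ (mk P Q a), h₂ _ (mk Q Q a)] }
  obtain ⟨D, hD⟩ := LinearMap.exists_extend (p := Subalgebra.toSubmodule 𝒜) δ
  have hDa : ∀ a : 𝒜, D (a : B) = δ a := fun a => LinearMap.congr_fun hD a
  have hJ : ∀ a ∈ 𝒜, ∀ b ∈ 𝒜, a * b =
      ((P * C * P : 𝒜) : B) + ((P * C * Q : 𝒜) : B) + ((Q * C * Q : 𝒜) : B) →
      JordanLeibniz D a b := by
    intro a ha b hb hab
    rw [← eq_add_corners hQ hC] at hab
    have e := hδ ⟨a, ha⟩ ⟨b, hb⟩ (Subtype.ext hab)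
    simp only [← hDa] at e
    exact e
  have main := T.leibniz_of_jordanLeibniz_at (fun h => hP0 (Subtype.ext h)) hchar ht D
    (mk P P C) (mk P Q C) (mk Q Q C) hJ
  intro a b ha hb
  have e := main _ (mk P P a) _ (mk P Q a) _ (mk Q Q a) _ (mk P P b) _ (mk P Q b) _ (mk Q Q b)
  rw [← eq_add_corners hQ ha, ← eq_add_corners hQ hb, ← MulMemClass.coe_mul, hDa, hDa, hDa] at e
  exact e
end

section
/- Suppose 𝒜₁₂ is faithful to ℬ, 𝒜₂₁ = {0} (i.e. QAP = 0 for all A ∈ 𝒜), and C(𝒜, ℬ) = 𝔽I. If a linear map δ : 𝒜 → ℬ is Jordan derivable at some C ∈ 𝒜, then δ is a derivation, i.e. δ(AB) = δ(A)B + Aδ(B) for all A, B ∈ 𝒜. In particular, every C ∈ 𝒜 is a Jordan all-derivable point and every Jordan derivation from 𝒜 to ℬ is a derivation. -/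
namespace PeirceTriangular

variable {𝔽 B : Type*} [Field 𝔽] [Ring B] [Algebra 𝔽 B] {𝒜 : Subalgebra 𝔽 B}

/-- `x` lies in the Peirce corner `E 𝒜 F`. -/
def InCorner (E F x : 𝒜) : Prop := E * x = x ∧ x * F = x

/-- `P` and `Q` are complementary idempotents of `𝒜` with `Q 𝒜 P = 0`, the corner `P 𝒜 Q` is
faithful to `B`, and the centralizer of `𝒜` in `B` consists of the scalars. -/
structure IsFaithfulTriangular (P Q : 𝒜) : Prop where
  idem_left : P * P = P
  idem_right : Q * Q = Q
  left_mul_right : P * Q = 0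
  right_mul_left : Q * P = 0
  add_eq_one : P + Q = 1
  lower_eq_zero : ∀ a : 𝒜, Q * a * P = 0
  faithful_left : ∀ N : B, (∀ L : 𝒜, InCorner P Q L → N * (L : B) = 0) → N * (P : B) = 0
  faithful_right : ∀ N : B, (∀ L : 𝒜, InCorner P Q L → (L : B) * N = 0) → (Q : B) * N = 0
  center : ∀ N : B, (∀ a : 𝒜, (a : B) * N = N * (a : B)) → ∃ k : 𝔽, N = k • (1 : B)

/-- The right-hand side of the Jordan–Leibniz rule for `δ`. -/
def jordanLeibniz (δ : 𝒜 →ₗ[𝔽] B) (a b : 𝒜) : B :=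
  δ a * (b : B) + (a : B) * δ b + δ b * (a : B) + (b : B) * δ a

/-- The Jordan–Leibniz relations between different Peirce corners. -/
structure IsPeirceJordan (P Q : 𝒜) (δ : 𝒜 →ₗ[𝔽] B) : Prop where
  diag : ∀ x y : 𝒜, InCorner P P x → InCorner Q Q y → jordanLeibniz δ x y = 0
  left : ∀ x L : 𝒜, InCorner P P x → InCorner P Q L →
    jordanLeibniz δ x L = jordanLeibniz δ (x * L) Q
  right : ∀ L y : 𝒜, InCorner P Q L → InCorner Q Q y →
    jordanLeibniz δ P (L * y) = jordanLeibniz δ L y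
  upper : ∀ L M : 𝒜, InCorner P Q L → InCorner P Q M → jordanLeibniz δ L M = 0

section jordanLeibniz

variable (δ : 𝒜 →ₗ[𝔽] B)

lemma jordanLeibniz_comm (a b : 𝒜) : jordanLeibniz δ a b = jordanLeibniz δ b a := by
  unfold jordanLeibniz; abel

lemma jordanLeibniz_add_left (a b c : 𝒜) :
    jordanLeibniz δ (a + b) c = jordanLeibniz δ a c + jordanLeibniz δ b c := by
  simp only [jordanLeibniz, map_add, Subalgebra.coe_add, add_mul, mul_add]; abel

lemma jordanLeibniz_smul_left (k : 𝔽) (a c : 𝒜) :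
    jordanLeibniz δ (k • a) c = k • jordanLeibniz δ a c := by
  simp only [jordanLeibniz, map_smul, Subalgebra.coe_smul, smul_mul_assoc, mul_smul_comm, smul_add]

lemma jordanLeibniz_add_right (a b c : 𝒜) :
    jordanLeibniz δ c (a + b) = jordanLeibniz δ c a + jordanLeibniz δ c b := by
  simp only [jordanLeibniz_comm δ c, jordanLeibniz_add_left]

lemma jordanLeibniz_smul_right (k : 𝔽) (a c : 𝒜) :
    jordanLeibniz δ c (k • a) = k • jordanLeibniz δ c a := by
  simp only [jordanLeibniz_comm δ c, jordanLeibniz_smul_left]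

lemma jordanLeibniz_neg_left (a c : 𝒜) : jordanLeibniz δ (-a) c = -jordanLeibniz δ a c := by
  simpa using jordanLeibniz_smul_left δ (-1 : 𝔽) a c

lemma jordanLeibniz_neg_right (a c : 𝒜) : jordanLeibniz δ c (-a) = -jordanLeibniz δ c a := by
  simpa using jordanLeibniz_smul_right δ (-1 : 𝔽) a c

lemma jordanLeibniz_zero_left (c : 𝒜) : jordanLeibniz δ 0 c = 0 := by
  simp [jordanLeibniz]

/-- An identity between Jordan–Leibniz expressions that are linear in `x` extends from a set to
its linear span. -/
lemma jordanLeibniz_eq_of_mem_span {S : Set 𝒜} (f : 𝒜 →ₗ[𝔽] 𝒜) (g : 𝒜 →ₗ[𝔽] 𝒜) (b c : 𝒜)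
    (h : ∀ x ∈ S, jordanLeibniz δ (g x) b = jordanLeibniz δ (f x) c) {x : 𝒜}
    (hx : x ∈ Submodule.span 𝔽 S) : jordanLeibniz δ (g x) b = jordanLeibniz δ (f x) c := by
  induction hx using Submodule.span_induction with
  | mem x hx => exact h x hx
  | zero => simp [jordanLeibniz_zero_left]
  | add x y _ _ hx hy => simp only [map_add, jordanLeibniz_add_left, hx, hy]
  | smul k x _ hx => simp only [map_smul, jordanLeibniz_smul_left, hx]

end jordanLeibniz

namespace InCorner

lemma coe_left {E F x : 𝒜} (h : InCorner E F x) : (E : B) * x = x := by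
  exact_mod_cast congrArg Subtype.val h.1

lemma coe_right {E F x : 𝒜} (h : InCorner E F x) : (x : B) * F = x := by
  exact_mod_cast congrArg Subtype.val h.2

lemma mul_eq_zero {E F G H x y : 𝒜} (hx : InCorner E F x) (hy : InCorner G H y)
    (h : F * G = 0) : x * y = 0 := by
  rw [← hx.2, ← hy.1, mul_assoc, ← mul_assoc F, h, zero_mul, mul_zero]

lemma coe_mul_eq_zero {E F G H x y : 𝒜} (hx : InCorner E F x) (hy : InCorner G H y)
    (h : F * G = 0) : (x : B) * y = 0 := by
  exact_mod_cast congrArg Subtype.val (mul_eq_zero hx hy h)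

lemma mul {E F G H x y : 𝒜} (hx : InCorner E F x) (hy : InCorner G H y) :
    InCorner E H (x * y) :=
  ⟨by rw [← mul_assoc, hx.1], by rw [mul_assoc, hy.2]⟩

lemma add {E F x y : 𝒜} (hx : InCorner E F x) (hy : InCorner E F y) : InCorner E F (x + y) :=
  ⟨by rw [mul_add, hx.1, hy.1], by rw [add_mul, hx.2, hy.2]⟩

lemma neg {E F x : 𝒜} (hx : InCorner E F x) : InCorner E F (-x) :=
  ⟨by rw [mul_neg, hx.1], by rw [neg_mul, hx.2]⟩

lemma of_eq {E F x : 𝒜} (hE : E * E = E) (hF : F * F = F) (h : x = E * x * F) :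
    InCorner E F x := by
  constructor
  · rw [h, ← mul_assoc, ← mul_assoc, hE]
  · rw [h, mul_assoc, hF]

lemma sandwich {E F : 𝒜} (hE : E * E = E) (hF : F * F = F) (a : 𝒜) :
    InCorner E F (E * a * F) :=
  ⟨by rw [← mul_assoc, ← mul_assoc, hE], by rw [mul_assoc, hF]⟩

end InCorner

namespace IsFaithfulTriangular

variable {P Q : 𝒜}

lemma corner_left (hT : IsFaithfulTriangular P Q) : InCorner P P P :=
  ⟨hT.idem_left, hT.idem_left⟩

lemma corner_right (hT : IsFaithfulTriangular P Q) : InCorner Q Q Q :=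
  ⟨hT.idem_right, hT.idem_right⟩

lemma coe_add (hT : IsFaithfulTriangular P Q) : (P : B) + Q = 1 := by
  exact_mod_cast congrArg Subtype.val hT.add_eq_one

/-- The Peirce decomposition of an element. -/
lemma exists_decomposition (hT : IsFaithfulTriangular P Q) (a : 𝒜) :
    ∃ x L y, InCorner P P x ∧ InCorner P Q L ∧ InCorner Q Q y ∧ a = x + L + y := by
  refine ⟨P * a * P, P * a * Q, Q * a * Q, .sandwich hT.idem_left hT.idem_left a,
    .sandwich hT.idem_left hT.idem_right a, .sandwich hT.idem_right hT.idem_right a, ?_⟩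
  calc a = (P + Q) * a * (P + Q) := by rw [hT.add_eq_one, one_mul, mul_one]
    _ = P * a * P + P * a * Q + Q * a * Q + Q * a * P := by noncomm_ring
    _ = _ := by rw [hT.lower_eq_zero, add_zero]

/-- An element commuting with each Peirce corner is a scalar. -/
lemma exists_scalar (hT : IsFaithfulTriangular P Q) {N : B}
    (h₁ : ∀ x : 𝒜, InCorner P P x → (x : B) * N = N * x)
    (h₂ : ∀ L : 𝒜, InCorner P Q L → (L : B) * N = N * L)
    (h₃ : ∀ y : 𝒜, InCorner Q Q y → (y : B) * N = N * y) : ∃ k : 𝔽, N = k • (1 : B) := by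
  refine hT.center N fun a => ?_
  obtain ⟨x, L, y, hx, hL, hy, rfl⟩ := hT.exists_decomposition a
  push_cast
  rw [add_mul, add_mul, mul_add, mul_add, h₁ x hx, h₂ L hL, h₃ y hy]

end IsFaithfulTriangular

lemma eq_zero_of_add_self (hchar : (2 : 𝔽) ≠ 0) {b : B} (h : b + b = 0) : b = 0 := by
  rw [← two_smul 𝔽 b] at h
  exact (smul_eq_zero.mp h).resolve_left hchar

variable {P Q : 𝒜} {δ : 𝒜 →ₗ[𝔽] B}

/-- A map satisfying the Peirce–Jordan relations and annihilating both idempotents is a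
derivation. -/
lemma IsPeirceJordan.leibniz_of_map_eq_zero (hchar : (2 : 𝔽) ≠ 0)
    (hT : IsFaithfulTriangular P Q) (hJ : IsPeirceJordan P Q δ) (hP : δ P = 0) (hQ : δ Q = 0)
    (a b : 𝒜) : δ (a * b) = δ a * (b : B) + (a : B) * δ b := by
  have cP := hT.corner_left
  have cQ := hT.corner_right
  have PQ := hT.left_mul_right
  have QP := hT.right_mul_left
  have hone := hT.coe_add
  have PP' : (P : B) * P = P := cP.coe_left
  have QQ' : (Q : B) * Q = Q := cQ.coe_left
  have PQ' : (P : B) * Q = 0 := cP.coe_mul_eq_zero cQ PQ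
  have QP' : (Q : B) * P = 0 := cQ.coe_mul_eq_zero cP QP
  have split_left (n : B) : (P : B) * n + Q * n = n := by rw [← add_mul, hone, one_mul]
  have split_right (n : B) : n * (P : B) + n * Q = n := by rw [← mul_add, hone, mul_one]
  have antic {e n : B} (he : e * e = e) (h : n * e + e * n = 0) : n * e = 0 ∧ e * n = 0 := by
    have h1 : n * e + e * n * e = 0 := by
      simpa [add_mul, mul_assoc, he] using congrArg (· * e) h
    have h2 : e * n * e + e * n = 0 := by
      simpa [mul_add, ← mul_assoc, he] using congrArg (e * ·) h
    have h3 : e * n * e + e * n * e = 0 := by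
      simpa [add_mul, mul_assoc, he] using congrArg (· * e) h2
    have h4 := eq_zero_of_add_self hchar h3
    rw [h4] at h1 h2
    exact ⟨by simpa using h1, by simpa using h2⟩
  have dx {x : 𝒜} (hx : InCorner P P x) : δ x * Q = 0 ∧ Q * δ x = 0 := by
    have h := hJ.diag x Q hx cQ
    simp only [jordanLeibniz, hQ, mul_zero, zero_mul, add_zero] at h
    exact antic QQ' h
  have dy {y : 𝒜} (hy : InCorner Q Q y) : δ y * P = 0 ∧ P * δ y = 0 := by
    have h := hJ.diag P y cP hy
    simp only [jordanLeibniz, hP, mul_zero, zero_mul, add_zero, zero_add] at h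
    rw [add_comm] at h
    exact antic PP' h
  have dL {L : 𝒜} (hL : InCorner P Q L) : (P : B) * δ L + δ L * P = δ L := by
    have h := hJ.left P L cP hL
    rw [hL.1] at h
    simp only [jordanLeibniz, hP, hQ, mul_zero, zero_mul, add_zero, zero_add] at h
    have h2 : ((P : B) * δ L + δ L * P) + (P * δ L + δ L * P) = δ L + δ L := by
      nth_rewrite 2 [h]
      calc _ = (P * δ L + Q * δ L) + (δ L * P + δ L * Q) := by abel
        _ = _ := by rw [split_left, split_right]
    have h3 : ((P : B) * δ L + δ L * P - δ L) + (P * δ L + δ L * P - δ L) = 0 := by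
      rw [← sub_eq_zero] at h2
      rw [← h2]; abel
    exact sub_eq_zero.mp (eq_zero_of_add_self hchar h3)
  have dLPP {L : 𝒜} (hL : InCorner P Q L) : (P : B) * δ L * P = 0 := by
    have h := congrArg ((P : B) * ·) (dL hL)
    simpa [mul_add, ← mul_assoc, PP'] using h
  -- `δ L * P = Q * δ L` is the lower-left component of `δ L`
  have g_eq {L : 𝒜} (hL : InCorner P Q L) : (Q : B) * δ L = δ L * P := by
    have h := split_left (δ L)
    nth_rewrite 3 [← dL hL] at h
    exact add_left_cancel h
  have hxL {x L : 𝒜} (hx : InCorner P P x) (hL : InCorner P Q L) :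
      δ (x * L) = δ x * L + x * δ L + δ L * x := by
    have h := hJ.left x L hx hL
    have h' := hJ.left P (x * L) cP (hx.mul hL)
    rw [(hx.mul hL).1, ← h] at h'
    simp only [jordanLeibniz, hP, mul_zero, zero_mul, add_zero, zero_add] at h'
    rw [dL (hx.mul hL)] at h'
    rw [h', ← hL.coe_right, mul_assoc _ _ (δ x), (dx hx).2, hL.coe_right]
    simp
  have hLy {L y : 𝒜} (hL : InCorner P Q L) (hy : InCorner Q Q y) :
      δ (L * y) = δ L * y + L * δ y + y * δ L := by
    have h := hJ.right L y hL hy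
    simp only [jordanLeibniz, hP, mul_zero, zero_mul, add_zero, zero_add] at h
    rw [dL (hL.mul hy)] at h
    have h0 : δ y * (L : B) = 0 := by rw [← hL.coe_left, ← mul_assoc, (dy hy).1, zero_mul]
    rw [h, h0, add_zero]
  have hLM {L M : 𝒜} (hL : InCorner P Q L) (hM : InCorner P Q M) :
      (L : B) * (δ M * P) = -(M * (δ L * P)) ∧ δ L * P * M = -(δ M * P * L) := by
    have h := hJ.upper L M hL hM
    unfold jordanLeibniz at h
    constructor
    · have h1 := congrArg (fun n : B => n * P) h
      simp only [add_mul, mul_assoc, hL.coe_mul_eq_zero cP QP, hM.coe_mul_eq_zero cP QP,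
        mul_zero, zero_mul, zero_add, add_zero] at h1
      exact eq_neg_of_add_eq_zero_left h1
    · have h1 := congrArg (fun n : B => Q * n) h
      simp only [mul_add, ← mul_assoc, cQ.coe_mul_eq_zero hL QP, cQ.coe_mul_eq_zero hM QP,
        g_eq hL, g_eq hM, mul_zero, zero_mul, add_zero] at h1
      exact eq_neg_of_add_eq_zero_left h1
  have gL {L : 𝒜} (hL : InCorner P Q L) : δ L * P = 0 := by
    have key : ∀ K : 𝒜, InCorner P Q K → (K : B) * (δ L * P) = 0 := by
      intro K hK
      have g_zero {c : B} {M : 𝒜} (hM : InCorner P Q M) (hc : c * Q = 0) :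
          c * (δ M * P) = 0 := by
        rw [← g_eq hM, ← mul_assoc, hc, zero_mul]
      have hscalar : ∃ k : 𝔽, K * (δ L * P) + δ K * P * L = k • (1 : B) := by
        refine hT.exists_scalar ?_ ?_ ?_
        · intro x hx
          have e1 : δ L * (P : B) * x = δ (x * L) * P := by
            have xP : (x : B) * δ L * P = 0 := by
              rw [← hx.coe_right, mul_assoc, mul_assoc, ← mul_assoc (P : B), dLPP hL, mul_zero]
            rw [hxL hx hL, add_mul, add_mul, mul_assoc (δ x), hL.coe_mul_eq_zero cP QP, xP,
              mul_assoc, mul_assoc, hx.coe_left, hx.coe_right]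
            simp
          have e2 : (x : B) * (δ K * P) = 0 :=
            g_zero hK (hx.coe_mul_eq_zero cQ PQ)
          rw [mul_add, ← mul_assoc (x : B) (δ K * P), e2, zero_mul, add_zero, add_mul,
            mul_assoc _ (L : B), hL.coe_mul_eq_zero hx QP, mul_zero, add_zero, mul_assoc (K : B), e1,
            (hLM hK (hx.mul hL)).1, Subalgebra.coe_mul, (hLM hK hL).1]
          simp [mul_assoc]
        · intro M hM
          have e1 : (M : B) * (δ K * P) * L = K * (δ L * P) * M := by
            rw [(hLM hM hK).1, neg_mul, mul_assoc, (hLM hM hL).2, mul_neg, neg_neg,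
              ← mul_assoc (K : B)]
          rw [mul_add, add_mul, ← mul_assoc, hM.coe_mul_eq_zero hK QP, zero_mul, zero_add,
            mul_assoc _ (L : B), hL.coe_mul_eq_zero hM QP, mul_zero, add_zero, ← mul_assoc, e1]
        · intro y hy
          have e1 : (y : B) * (δ L * P) = δ (L * y) * P := by
            rw [hLy hL hy, add_mul, add_mul, mul_assoc (L : B), (dy hy).1, mul_assoc (δ L),
              hy.coe_mul_eq_zero cP QP]
            simp [mul_assoc]
          have e2 : (P : B) * y = 0 := cP.coe_mul_eq_zero hy PQ
          rw [mul_add, ← mul_assoc, hy.coe_mul_eq_zero hK QP, zero_mul, zero_add, add_mul,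
            mul_assoc (K : B), mul_assoc (δ L), e2, mul_zero, mul_zero, zero_add,
            (hLM hK hL).2, mul_neg, ← mul_assoc, e1, ← (hLM hK hL).2,
            mul_assoc _ (L : B), ← Subalgebra.coe_mul,
            (hLM hK (hL.mul hy)).2]
      obtain ⟨k, hk⟩ := hscalar
      have h0 : δ L * P * L = 0 :=
        eq_zero_of_add_self hchar (by nth_rewrite 1 [(hLM hL hL).2]; simp)
      have h1 : (K * (δ L * P) + δ K * P * L) * L = 0 := by
        rw [add_mul, mul_assoc (K : B), h0, mul_assoc _ (L : B),
          hL.coe_mul_eq_zero hL QP]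
        simp
      have h2 : (K * (δ L * P) + δ K * P * L : B) = 0 := by
        rw [hk, smul_mul_assoc, one_mul, smul_eq_zero] at h1
        rcases h1 with h1 | h1
        · rw [hk, h1, zero_smul]
        · have : L = 0 := Subtype.ext h1
          simp [this]
      have h3 := congrArg ((P : B) * ·) h2
      simp only [mul_add, mul_zero] at h3
      rw [← mul_assoc, hK.coe_left, ← mul_assoc _ (δ K * P), g_zero hK PQ', zero_mul,
        add_zero] at h3
      exact h3
    rw [← hT.faithful_right _ key, ← g_eq hL, ← mul_assoc, QQ']
  have QdL {L : 𝒜} (hL : InCorner P Q L) : Q * δ L = 0 := by rw [g_eq hL, gL hL]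
  have hxL' {x L : 𝒜} (hx : InCorner P P x) (hL : InCorner P Q L) :
      δ (x * L) = δ x * L + x * δ L := by
    rw [hxL hx hL, ← hx.coe_left, ← mul_assoc (δ L), gL hL, zero_mul, add_zero]
  have hLy' {L y : 𝒜} (hL : InCorner P Q L) (hy : InCorner Q Q y) :
      δ (L * y) = δ L * y + L * δ y := by
    rw [hLy hL hy, ← hy.coe_right, mul_assoc (y : B), QdL hL, mul_zero, add_zero]
  have hxx {x z : 𝒜} (hx : InCorner P P x) (hz : InCorner P P z) :
      δ (x * z) = δ x * z + x * δ z := by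
    have h := hT.faithful_left (δ (x * z) - (δ x * z + x * δ z)) fun L hL => by
      have h1 := hxL' (hx.mul hz) hL
      rw [mul_assoc, hxL' hx (hz.mul hL), hxL' hz hL] at h1
      push_cast at h1
      rw [← sub_eq_zero] at h1
      rw [← neg_eq_zero, ← h1]
      noncomm_ring
    have h0 : (δ (x * z) - (δ x * z + x * δ z)) * Q = 0 := by
      rw [sub_mul, add_mul, (dx (hx.mul hz)).1, mul_assoc, mul_assoc, (dx hz).1,
        hz.coe_mul_eq_zero cQ PQ]
      simp
    rw [← sub_eq_zero, ← split_right (_ - _), h, h0, add_zero]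
  have hyy {y z : 𝒜} (hy : InCorner Q Q y) (hz : InCorner Q Q z) :
      δ (y * z) = δ y * z + y * δ z := by
    have h := hT.faithful_right (δ (y * z) - (δ y * z + y * δ z)) fun L hL => by
      have h1 := hLy' hL (hy.mul hz)
      rw [← mul_assoc, hLy' (hL.mul hy) hz, hLy' hL hy] at h1
      push_cast at h1
      rw [← sub_eq_zero] at h1
      rw [← neg_eq_zero, ← h1]
      noncomm_ring
    have h0 : P * (δ (y * z) - (δ y * z + y * δ z)) = 0 := by
      rw [mul_sub, mul_add, (dy (hy.mul hz)).2, ← mul_assoc, ← mul_assoc, (dy hy).2,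
        cP.coe_mul_eq_zero hy PQ]
      simp
    rw [← sub_eq_zero, ← split_left (_ - _), h, h0, add_zero]
  obtain ⟨x, L, y, hx, hL, hy, rfl⟩ := hT.exists_decomposition a
  obtain ⟨x', L', y', hx', hL', hy', rfl⟩ := hT.exists_decomposition b
  have z1 : δ x * (y' : B) = 0 := by rw [← hy'.coe_left, ← mul_assoc, (dx hx).1, zero_mul]
  have z2 : (x : B) * δ y' = 0 := by rw [← hx.coe_right, mul_assoc, (dy hy').2, mul_zero]
  have z3 : δ L * (x' : B) = 0 := by rw [← hx'.coe_left, ← mul_assoc, gL hL, zero_mul]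
  have z4 : (L : B) * δ x' = 0 := by rw [← hL.coe_right, mul_assoc, (dx hx').2, mul_zero]
  have z5 : δ L * (L' : B) = 0 := by rw [← hL'.coe_left, ← mul_assoc, gL hL, zero_mul]
  have z6 : (L : B) * δ L' = 0 := by rw [← hL.coe_right, mul_assoc, QdL hL', mul_zero]
  have z7 : δ y * (x' : B) = 0 := by rw [← hx'.coe_left, ← mul_assoc, (dy hy).1, zero_mul]
  have z8 : (y : B) * δ x' = 0 := by rw [← hy.coe_right, mul_assoc, (dx hx').2, mul_zero]
  have z9 : δ y * (L' : B) = 0 := by rw [← hL'.coe_left, ← mul_assoc, (dy hy).1, zero_mul]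
  have z10 : (y : B) * δ L' = 0 := by rw [← hy.coe_right, mul_assoc, QdL hL', mul_zero]
  have hprod : (x + L + y) * (x' + L' + y') = x * x' + x * L' + L * y' + y * y' := by
    simp only [add_mul, mul_add, hx.mul_eq_zero hy' PQ, hL.mul_eq_zero hx' QP,
      hL.mul_eq_zero hL' QP, hy.mul_eq_zero hx' QP, hy.mul_eq_zero hL' QP]
    abel
  rw [hprod]
  simp only [map_add, Subalgebra.coe_add, hxx hx hx', hxL' hx hL', hLy' hL hy', hyy hy hy',
    add_mul, mul_add, z1, z2, z3, z4, z5, z6, z7, z8, z9, z10]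
  abel

/-- A map satisfying the Peirce–Jordan relations sends `1` to a scalar. -/
lemma IsPeirceJordan.exists_map_one_eq_smul (hchar : (2 : 𝔽) ≠ 0)
    (hT : IsFaithfulTriangular P Q) (hJ : IsPeirceJordan P Q δ) : ∃ k : 𝔽, δ 1 = k • (1 : B) := by
  have cP := hT.corner_left
  have cQ := hT.corner_right
  have PQ := hT.left_mul_right
  have QP := hT.right_mul_left
  have hone := hT.coe_add
  have PP' : (P : B) * P = P := cP.coe_left
  have QQ' : (Q : B) * Q = Q := cQ.coe_left
  have PQ' : (P : B) * Q = 0 := cP.coe_mul_eq_zero cQ PQ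
  have QP' : (Q : B) * P = 0 := cQ.coe_mul_eq_zero cP QP
  have h0 := hJ.diag P Q cP cQ
  unfold jordanLeibniz at h0
  have hU : δ 1 = δ P + δ Q := by rw [← map_add, hT.add_eq_one]
  have hp : (Q : B) * δ P * Q = 0 := by
    have h := congrArg (fun n : B => Q * n * Q) h0
    simp only [mul_add, add_mul, mul_zero, zero_mul, mul_assoc, QQ', PQ'] at h
    simp only [← mul_assoc, QQ', QP', zero_mul, add_zero] at h
    exact eq_zero_of_add_self hchar h
  have hq : (P : B) * δ Q * P = 0 := by
    have h := congrArg (fun n : B => P * n * P) h0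
    simp only [mul_add, add_mul, mul_zero, zero_mul, mul_assoc, PP', QP'] at h
    simp only [← mul_assoc, PP', PQ', zero_mul, add_zero, zero_add] at h
    exact eq_zero_of_add_self hchar h
  have hPU : (P : B) * δ 1 * Q = 0 := by
    have h := congrArg (fun n : B => P * n * Q) h0
    simp only [mul_add, add_mul, mul_zero, zero_mul, mul_assoc, QQ', PQ'] at h
    simp only [← mul_assoc, PP', PQ', zero_mul, add_zero] at h
    rw [hU, mul_add, add_mul, h]
  have hQU : (Q : B) * δ 1 * P = 0 := by
    have h := congrArg (fun n : B => Q * n * P) h0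
    simp only [mul_add, add_mul, mul_zero, zero_mul, mul_assoc, PP', QP'] at h
    simp only [← mul_assoc, QQ', QP', zero_mul, add_zero, zero_add] at h
    rw [hU, mul_add, add_mul, add_comm, h]
  have PU : (P : B) * δ 1 = δ 1 * P := by
    calc (P : B) * δ 1 = P * δ 1 * P + P * δ 1 * Q := by rw [← mul_add, hone, mul_one]
      _ = P * δ 1 * P + Q * δ 1 * P := by rw [hPU, hQU]
      _ = δ 1 * P := by rw [mul_assoc, mul_assoc, ← add_mul, hone, one_mul]
  have QU : (Q : B) * δ 1 = δ 1 * Q := by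
    have : (Q : B) = 1 - P := by rw [← hone]; abel
    rw [this, sub_mul, mul_sub, PU]; simp
  have hL (L : 𝒜) (hL : InCorner P Q L) : (L : B) * δ 1 = δ 1 * L := by
    have h := hJ.left P L cP hL
    rw [hL.1] at h
    unfold jordanLeibniz at h
    have h := congrArg (fun n : B => P * n * Q) h
    simp only [mul_add, add_mul, mul_assoc, QQ', PQ', hL.coe_right] at h
    simp only [← mul_assoc, PP', PQ', hL.coe_left, mul_zero, zero_mul, add_zero] at h
    have LpQ : (L : B) * δ P * Q = 0 := by
      rw [← hL.coe_right, mul_assoc, mul_assoc, ← mul_assoc (Q : B), hp, mul_zero]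
    have PqL : (P : B) * δ Q * L = 0 := by
      rw [← hL.coe_left, ← mul_assoc, hq, zero_mul]
    rw [LpQ, PqL] at h
    have h : (P : B) * δ P * L = L * δ Q * Q := by
      simp only [add_zero] at h
      rw [add_comm] at h
      exact add_left_cancel h
    calc (L : B) * δ 1 = L * (Q * δ 1) := by rw [← mul_assoc, hL.coe_right]
      _ = L * δ Q * Q := by rw [QU, hU, ← mul_assoc, mul_add, add_mul, LpQ, zero_add]
      _ = P * δ 1 * L := by rw [← h, hU, mul_add, add_mul, PqL, add_zero]
      _ = δ 1 * L := by rw [PU, mul_assoc, hL.coe_left]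
  refine hT.exists_scalar (fun x hx => ?_) hL fun y hy => ?_
  · have h := hT.faithful_left (x * δ 1 - δ 1 * x) fun L hL' => by
      rw [sub_mul, mul_assoc, ← hL L hL', ← mul_assoc, ← Subalgebra.coe_mul,
        hL _ (hx.mul hL'), mul_assoc, Subalgebra.coe_mul, sub_self]
    rwa [sub_mul, mul_assoc, ← PU, ← mul_assoc, mul_assoc (δ 1), hx.coe_right, sub_eq_zero] at h
  · have h := hT.faithful_right (y * δ 1 - δ 1 * y) fun L hL' => by
      rw [mul_sub, ← mul_assoc, ← mul_assoc, hL L hL', mul_assoc (δ 1), ← Subalgebra.coe_mul,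
        hL _ (hL'.mul hy), sub_self]
    rwa [mul_sub, ← mul_assoc, ← mul_assoc, QU, mul_assoc (δ 1), hy.coe_left, sub_eq_zero] at h

/-- The inner derivation `a ↦ t a - a t`. -/
def innerDerivation (𝒜 : Subalgebra 𝔽 B) (t : B) : 𝒜 →ₗ[𝔽] B :=
  (LinearMap.mulLeft 𝔽 t - LinearMap.mulRight 𝔽 t) ∘ₗ 𝒜.val.toLinearMap

lemma innerDerivation_apply (t : B) (a : 𝒜) : innerDerivation 𝒜 t a = t * a - a * t := rfl

lemma jordanLeibniz_sub_innerDerivation (δ : 𝒜 →ₗ[𝔽] B) (t : B) (a b : 𝒜) :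
    jordanLeibniz (δ - innerDerivation 𝒜 t) a b =
      jordanLeibniz δ a b - innerDerivation 𝒜 t (a * b + b * a) := by
  simp only [jordanLeibniz, LinearMap.sub_apply, innerDerivation_apply]
  push_cast
  noncomm_ring

lemma IsPeirceJordan.sub_innerDerivation (hT : IsFaithfulTriangular P Q)
    (hJ : IsPeirceJordan P Q δ) (t : B) : IsPeirceJordan P Q (δ - innerDerivation 𝒜 t) := by
  have PQ := hT.left_mul_right
  have QP := hT.right_mul_left
  constructor
  · intro x y hx hy
    rw [jordanLeibniz_sub_innerDerivation, hJ.diag x y hx hy, hx.mul_eq_zero hy PQ,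
      hy.mul_eq_zero hx QP]
    simp
  · intro x L hx hL
    rw [jordanLeibniz_sub_innerDerivation, jordanLeibniz_sub_innerDerivation, hJ.left x L hx hL,
      hL.mul_eq_zero hx QP, (hx.mul hL).2, hT.corner_right.mul_eq_zero (hx.mul hL) QP]
  · intro L y hL hy
    rw [jordanLeibniz_sub_innerDerivation, jordanLeibniz_sub_innerDerivation, hJ.right L y hL hy,
      hy.mul_eq_zero hL QP, (hL.mul hy).1, (hL.mul hy).mul_eq_zero hT.corner_left QP]
  · intro L M hL hM
    rw [jordanLeibniz_sub_innerDerivation, hJ.upper L M hL hM, hL.mul_eq_zero hM QP,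
      hM.mul_eq_zero hL QP]
    simp

/-- A map satisfying the Peirce–Jordan relations and annihilating `1` is a derivation. -/
lemma IsPeirceJordan.leibniz (hchar : (2 : 𝔽) ≠ 0) (hT : IsFaithfulTriangular P Q)
    (hJ : IsPeirceJordan P Q δ) (h1 : δ 1 = 0) (a b : 𝒜) :
    δ (a * b) = δ a * (b : B) + (a : B) * δ b := by
  have cP := hT.corner_left
  have cQ := hT.corner_right
  have hone := hT.coe_add
  have PP' : (P : B) * P = P := cP.coe_left
  have QQ' : (Q : B) * Q = Q := cQ.coe_left
  have PQ' : (P : B) * Q = 0 := cP.coe_mul_eq_zero cQ hT.left_mul_right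
  have QP' : (Q : B) * P = 0 := cQ.coe_mul_eq_zero cP hT.right_mul_left
  have hQ : δ Q = -δ P := by
    rw [eq_neg_iff_add_eq_zero, ← map_add, add_comm, hT.add_eq_one, h1]
  have h0 := hJ.diag P Q cP cQ
  simp only [jordanLeibniz, hQ] at h0
  have hp₁ : (P : B) * δ P * P = 0 := by
    have h := congrArg (fun n : B => P * n * P) h0
    simp only [mul_add, add_mul, mul_zero, zero_mul, mul_assoc, neg_mul, mul_neg, PP',
      QP'] at h
    simp only [← mul_assoc, PP', PQ', zero_mul, add_zero, zero_add] at h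
    exact eq_zero_of_add_self hchar (by rw [← neg_eq_zero, neg_add, h])
  have hp₂ : (Q : B) * δ P * Q = 0 := by
    have h := congrArg (fun n : B => Q * n * Q) h0
    simp only [mul_add, add_mul, mul_zero, zero_mul, mul_assoc, neg_mul, mul_neg, QQ',
      PQ'] at h
    simp only [← mul_assoc, QQ', QP', zero_mul, add_zero, neg_zero] at h
    exact eq_zero_of_add_self hchar h
  set t : B := Q * δ P * P - P * δ P * Q with ht
  have htP : innerDerivation 𝒜 t P = δ P := by
    have e : δ P = P * δ P * P + P * δ P * Q + Q * δ P * P + Q * δ P * Q := by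
      calc δ P = (P + Q) * δ P * (P + Q) := by rw [hone]; simp
        _ = _ := by noncomm_ring
    rw [innerDerivation_apply, ht, sub_mul, mul_sub, mul_assoc _ (P : B), PP',
      mul_assoc _ (Q : B), QP', ← mul_assoc, ← mul_assoc, PQ', ← mul_assoc, ← mul_assoc, PP']
    rw [hp₁, hp₂, zero_add, add_zero, add_comm] at e
    simpa using e.symm
  have htQ : innerDerivation 𝒜 t Q = δ Q := by
    rw [hQ, ← htP, innerDerivation_apply, innerDerivation_apply]
    have : (Q : B) = 1 - P := by rw [← hone]; abel
    rw [this]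
    noncomm_ring
  have h := (hJ.sub_innerDerivation hT t).leibniz_of_map_eq_zero hchar hT
    (by rw [LinearMap.sub_apply, htP, sub_self]) (by rw [LinearMap.sub_apply, htQ, sub_self]) a b
  have hi : innerDerivation 𝒜 t (a * b) =
      innerDerivation 𝒜 t a * b + a * innerDerivation 𝒜 t b := by
    simp only [innerDerivation_apply]
    push_cast
    noncomm_ring
  simp only [LinearMap.sub_apply] at h
  rw [sub_eq_iff_eq_add, hi] at h
  rw [h]
  noncomm_ring

/-- Jordan derivability at a single point, together with the Peirce–Jordan relations, forces
`δ 1 = 0`. -/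
lemma IsPeirceJordan.map_one_eq_zero_of_jordanDerivableAt (hchar : (2 : 𝔽) ≠ 0)
    (hT : IsFaithfulTriangular P Q) (hJ : IsPeirceJordan P Q δ) (hP0 : P ≠ 0) {C : 𝒜}
    (hδ : ∀ a b : 𝒜, a * b = C → δ (a * b + b * a) = jordanLeibniz δ a b) : δ 1 = 0 := by
  obtain ⟨k, hk⟩ := hJ.exists_map_one_eq_smul hchar hT
  have hone_left (a : 𝒜) : jordanLeibniz δ 1 a = (k • (a : B) + k • (a : B)) + (δ a + δ a) := by
    simp only [jordanLeibniz, hk, OneMemClass.coe_one, one_mul, mul_one, smul_mul_assoc,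
      mul_smul_comm]
    abel
  by_cases hC : C = 0
  · suffices hk0 : k = 0 by rw [hk, hk0, zero_smul]
    by_contra hk0
    have hzero (L : 𝒜) (hL : InCorner P Q L) : (L : B) = 0 := by
      have QL := hT.corner_right.mul_eq_zero hL hT.right_mul_left
      have h := hδ Q L (by rw [QL, hC])
      rw [QL, hL.2, zero_add] at h
      have h' := hJ.left P L hT.corner_left hL
      rw [hL.1, jordanLeibniz_comm δ L, ← h] at h'
      have h2 := hone_left L
      rw [← hT.add_eq_one, jordanLeibniz_add_left, h', ← h] at h2
      have h3 := eq_zero_of_add_self hchar (right_eq_add.mp h2)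
      exact (smul_eq_zero.mp h3).resolve_left hk0
    have h := hT.faithful_left 1 fun L hL => by rw [hzero L hL, mul_zero]
    exact hP0 (Subtype.ext (by simpa using h))
  · have h := hδ 1 C (one_mul C)
    rw [hone_left, one_mul, mul_one, map_add] at h
    have h3 := eq_zero_of_add_self hchar (right_eq_add.mp h)
    have hC' : (C : B) ≠ 0 := fun h => hC (Subtype.ext h)
    rw [hk, (smul_eq_zero.mp h3).resolve_right hC', zero_smul]

lemma eq_zero_of_forall_laurent_eq_zero (hchar : (2 : 𝔽) ≠ 0) (hcard : 4 ≤ Cardinal.mk 𝔽)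
    {a b c : B} (h : ∀ s : 𝔽, s ≠ 0 → s • a + b + s⁻¹ • c = 0) : a = 0 := by
  classical
  obtain ⟨s, hs⟩ : ∃ s : 𝔽, s ∉ ({0, 1, -1} : Finset 𝔽) := by
    by_contra! hall
    have hle : Cardinal.mk 𝔽 ≤ ({0, 1, -1} : Finset 𝔽).card := by
      rw [← Cardinal.mk_coe_finset]
      exact Cardinal.mk_le_of_injective (f := fun s => ⟨s, hall s⟩) fun _ _ h =>
        congrArg Subtype.val h
    have h3 : (4 : Cardinal) ≤ (3 : ℕ) :=
      (hcard.trans hle).trans (Nat.cast_le.mpr Finset.card_le_three)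
    have h4 : (4 : ℕ) ≤ 3 := by exact_mod_cast h3
    omega
  simp only [Finset.mem_insert, Finset.mem_singleton, not_or] at hs
  obtain ⟨s0, s1, s2⟩ := hs
  have h₁ := h 1 one_ne_zero
  have h₂ := h (-1) (neg_ne_zero.mpr one_ne_zero)
  have h₃ := h s s0
  simp only [one_smul, inv_one, neg_smul, inv_neg] at h₁ h₂
  have hb : b = 0 := eq_zero_of_add_self hchar (by
    calc b + b = (a + b + c) + (-a + b + -c) := by abel
      _ = 0 := by rw [h₁, h₂, add_zero])
  rw [hb, add_zero] at h₁ h₃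
  rw [eq_neg_of_add_eq_zero_right h₁, smul_neg, ← sub_eq_add_neg, ← sub_smul, smul_eq_zero] at h₃
  refine h₃.resolve_left fun hs => ?_
  have : (s - 1) * (s + 1) = 0 := by
    field_simp at hs
    linear_combination hs
  rcases mul_eq_zero.mp this with h | h
  · exact s1 (sub_eq_zero.mp h)
  · exact s2 (eq_neg_of_add_eq_zero_left h)

/-- The relations obtained from the factorizations
`C = (s • (x - x N y') + C y') * (s⁻¹ • x' C P + N + y)` with `x' = x⁻¹` and `y' = y⁻¹` inverses
in the diagonal corners. -/
lemma jordanLeibniz_eq_of_jordanDerivableAt (hchar : (2 : 𝔽) ≠ 0) (hcard : 4 ≤ Cardinal.mk 𝔽)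
    (hT : IsFaithfulTriangular P Q) {C : 𝒜}
    (hδ : ∀ a b : 𝒜, a * b = C → δ (a * b + b * a) = jordanLeibniz δ a b)
    {x x' y y' N : 𝒜} (hx : InCorner P P x) (hx' : InCorner P P x') (hxx : x * x' = P)
    (hy : InCorner Q Q y) (hy' : InCorner Q Q y') (hyy : y' * y = Q)
    (hN : InCorner P Q N) :
    jordanLeibniz δ (x - x * N * y') (N + y) = 0 := by
  have PQ := hT.left_mul_right
  have QP := hT.right_mul_left
  have cP := hT.corner_left
  have cQ := hT.corner_right
  have hW : InCorner P P (x' * C * P) := by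
    rw [← hx'.2, mul_assoc x' P]
    rw [mul_assoc x']
    exact hx'.mul (.sandwich hT.idem_left hT.idem_left C)
  have hM := (hx.mul hN).mul hy'
  have hxW : x * (x' * C * P) = C * P := by
    have h := hT.lower_eq_zero C
    calc x * (x' * C * P) = P * C * P := by rw [← mul_assoc, ← mul_assoc, hxx]
      _ = (P + Q) * C * P := by rw [add_mul, add_mul, h, add_zero]
      _ = C * P := by rw [hT.add_eq_one, one_mul]
  have hCy : C * y' * y = C * Q := by rw [mul_assoc, hyy]
  have hMy : x * N * y' * y = x * N := by rw [mul_assoc, hyy, mul_assoc, hN.2]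
  have hC : C * P + C * Q = C := by rw [← mul_add, hT.add_eq_one, mul_one]
  have hyW := hy'.mul_eq_zero hW QP
  have hyN := hy'.mul_eq_zero hN QP
  have hfac (s : 𝔽) (hs : s ≠ 0) :
      (s • (x - x * N * y') + C * y') * (s⁻¹ • (x' * C * P) + (N + y)) = C := by
    have e1 : (x - x * N * y') * (N + y) = 0 := by
      rw [sub_mul, mul_add, mul_add, hx.mul_eq_zero hy PQ, hM.mul_eq_zero hN QP, hMy]
      simp
    have e2 : C * y' * (x' * C * P) = 0 := by rw [mul_assoc, hyW, mul_zero]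
    have e3 : C * y' * (N + y) = C * Q := by rw [mul_add, mul_assoc, hyN, hCy]; simp
    rw [add_mul, mul_add, mul_add (C * y'), smul_mul_assoc, mul_smul_comm, smul_smul,
      mul_inv_cancel₀ hs, one_smul, sub_mul, hxW, hM.mul_eq_zero hW QP, smul_mul_assoc, e1,
      mul_smul_comm, e2, e3]
    simpa using hC
  have hprod (s : 𝔽) (hs : s ≠ 0) : (s⁻¹ • (x' * C * P) + (N + y)) *
      (s • (x - x * N * y') + C * y') = (x' * C * P * (x - x * N * y') + (N + y) * (C * y')) +
        s⁻¹ • (x' * C * P * (C * y')) := by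
    have e1 : (N + y) * (x - x * N * y') = 0 := by
      rw [add_mul, mul_sub, mul_sub, hN.mul_eq_zero hx QP, hN.mul_eq_zero hM QP,
        hy.mul_eq_zero hx QP, hy.mul_eq_zero hM QP]
      simp
    rw [add_mul, mul_add, mul_add, smul_mul_assoc, mul_smul_comm, smul_smul,
      inv_mul_cancel₀ hs, one_smul, smul_mul_assoc, mul_smul_comm, e1, smul_zero]
    abel
  refine eq_zero_of_forall_laurent_eq_zero hchar hcard
    (b := jordanLeibniz δ (x - x * N * y') (x' * C * P) + jordanLeibniz δ (C * y') (N + y) -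
      δ (C + (x' * C * P * (x - x * N * y') + (N + y) * (C * y'))))
    (c := jordanLeibniz δ (C * y') (x' * C * P) - δ (x' * C * P * (C * y'))) fun s hs => ?_
  have h := hδ _ _ (hfac s hs)
  rw [hfac s hs, hprod s hs] at h
  simp only [jordanLeibniz_add_left, jordanLeibniz_add_right _ (s⁻¹ • _),
    jordanLeibniz_smul_left, jordanLeibniz_smul_right, smul_add, smul_smul, inv_mul_cancel₀ hs,
    one_smul, map_add _ C, map_add _ _ (s⁻¹ • _), map_smul] at h
  rw [← sub_eq_zero] at h
  rw [← neg_eq_zero, ← h, map_add, smul_sub]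
  abel

/-- Jordan derivability at a single point implies the Peirce–Jordan relations. -/
lemma isPeirceJordan_of_jordanDerivableAt (hchar : (2 : 𝔽) ≠ 0) (hcard : 4 ≤ Cardinal.mk 𝔽)
    (hT : IsFaithfulTriangular P Q)
    (hinv₁ : ∀ x : 𝒜, InCorner P P x → x ∈ Submodule.span 𝔽
      {x : 𝒜 | x = P * x * P ∧ ∃ y, y = P * y * P ∧ x * y = P ∧ y * x = P})
    (hinv₂ : ∀ y : 𝒜, InCorner Q Q y → y ∈ Submodule.span 𝔽
      {x : 𝒜 | x = Q * x * Q ∧ ∃ y, y = Q * y * Q ∧ x * y = Q ∧ y * x = Q})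
    {C : 𝒜} (hδ : ∀ a b : 𝒜, a * b = C → δ (a * b + b * a) = jordanLeibniz δ a b) :
    IsPeirceJordan P Q δ := by
  have cP := hT.corner_left
  have cQ := hT.corner_right
  have diag_unit {x x' y y' : 𝒜} (hx : InCorner P P x) (hx' : InCorner P P x')
      (hxx : x * x' = P) (hy : InCorner Q Q y) (hy' : InCorner Q Q y') (hyy : y' * y = Q) :
      jordanLeibniz δ x y = 0 := by
    have hN : InCorner P Q (0 : 𝒜) := ⟨mul_zero _, zero_mul _⟩
    simpa using jordanLeibniz_eq_of_jordanDerivableAt hchar hcard hT hδ hx hx' hxx hy hy' hyy hN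
  have upper_unit {x x' y y' N : 𝒜} (hx : InCorner P P x) (hx' : InCorner P P x')
      (hxx : x * x' = P) (hy : InCorner Q Q y) (hy' : InCorner Q Q y') (hyy : y' * y = Q)
      (hN : InCorner P Q N) : jordanLeibniz δ (x * N * y') N = 0 ∧
        jordanLeibniz δ x N = jordanLeibniz δ (x * N * y') y := by
    have h0 := diag_unit hx hx' hxx hy hy' hyy
    have h1 := jordanLeibniz_eq_of_jordanDerivableAt hchar hcard hT hδ hx hx' hxx hy hy' hyy hN
    have h2 :=
      jordanLeibniz_eq_of_jordanDerivableAt hchar hcard hT hδ hx hx' hxx hy hy' hyy hN.neg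
    simp only [sub_eq_add_neg, mul_neg, neg_mul, neg_neg, jordanLeibniz_add_left,
      jordanLeibniz_add_right, jordanLeibniz_neg_left, jordanLeibniz_neg_right, h0,
      zero_add] at h1 h2
    have h3 : jordanLeibniz δ (x * N * y') N = 0 := by
      refine neg_eq_zero.mp (eq_zero_of_add_self hchar ?_)
      have h := congrArg₂ (· + ·) h1 h2
      rw [add_zero] at h
      rw [← h]
      abel
    refine ⟨h3, ?_⟩
    rw [← sub_eq_zero, ← h1, h3]
    abel
  have upper_self {L : 𝒜} (hL : InCorner P Q L) : jordanLeibniz δ L L = 0 := by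
    have h := (upper_unit cP cP hT.idem_left cQ cQ hT.idem_right hL).1
    rwa [hL.1, hL.2] at h
  constructor
  · intro x y hx hy
    have h := jordanLeibniz_eq_of_mem_span δ 0 LinearMap.id y 0 ?_ (hinv₁ x hx)
    · simpa [jordanLeibniz_zero_left] using h
    rintro x ⟨hx, x', hx', hxx, -⟩
    have h := jordanLeibniz_eq_of_mem_span δ 0 LinearMap.id x 0 ?_ (hinv₂ y hy)
    · simpa [jordanLeibniz_zero_left, jordanLeibniz_comm δ x] using h
    rintro y ⟨hy, y', hy', -, hyy⟩
    simpa [jordanLeibniz_zero_left, jordanLeibniz_comm δ y] using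
      diag_unit (.of_eq hT.idem_left hT.idem_left hx) (.of_eq hT.idem_left hT.idem_left hx') hxx
        (.of_eq hT.idem_right hT.idem_right hy) (.of_eq hT.idem_right hT.idem_right hy') hyy
  · intro x L hx hL
    refine jordanLeibniz_eq_of_mem_span δ (LinearMap.mulRight 𝔽 L) LinearMap.id L Q ?_
      (hinv₁ x hx)
    rintro x ⟨hx, x', hx', hxx, -⟩
    have h := (upper_unit (.of_eq hT.idem_left hT.idem_left hx)
      (.of_eq hT.idem_left hT.idem_left hx') hxx cQ cQ hT.idem_right hL).2
    rwa [mul_assoc, hL.2] at h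
  · intro L y hL hy
    rw [jordanLeibniz_comm, jordanLeibniz_comm δ L]
    refine jordanLeibniz_eq_of_mem_span δ LinearMap.id (LinearMap.mulLeft 𝔽 L) P L ?_
      (hinv₂ y hy)
    rintro y ⟨hy, y', hy', hyy', hyy⟩
    have cy := InCorner.of_eq hT.idem_right hT.idem_right hy
    have h := (upper_unit cP cP hT.idem_left cy (.of_eq hT.idem_right hT.idem_right hy') hyy
      (hL.mul cy)).2
    rw [(hL.mul cy).1, mul_assoc L, hyy', hL.2] at h
    rw [LinearMap.mulLeft_apply, LinearMap.id_apply, jordanLeibniz_comm, h, jordanLeibniz_comm]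
  · intro L M hL hM
    have h := upper_self (hL.add hM)
    simp only [jordanLeibniz_add_left, jordanLeibniz_add_right, upper_self hL, upper_self hM,
      jordanLeibniz_comm δ M L, zero_add, add_zero] at h
    exact eq_zero_of_add_self hchar h

end PeirceTriangular

open PeirceTriangular in
/-- if `𝒜₁₂` is faithful to `ℬ`, `𝒜₂₁ = {0}` and `C(𝒜, ℬ) = 𝔽I`, then every
linear map `δ : 𝒜 → ℬ` Jordan derivable at some `C ∈ 𝒜` is a derivation; in particular every
`C ∈ 𝒜` is a Jordan all-derivable point and every Jordan derivation from `𝒜` to `ℬ`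
is a derivation. -/
theorem statement5 {𝔽 B : Type*} [Field 𝔽] [Ring B] [Algebra 𝔽 B]
    -- the field has characteristic ≠ 2 and at least 4 elements
    (hchar : (2 : 𝔽) ≠ 0) (hcard : 4 ≤ Cardinal.mk 𝔽)
    -- `𝒜` is a unital subalgebra of `ℬ` (same identity)
    (𝒜 : Subalgebra 𝔽 B)
    -- `P ∈ 𝒜` is a nontrivial idempotent; `Q = 1 - P`
    (P Q : 𝒜) (hP : P * P = P) (hP0 : P ≠ 0) (hP1 : P ≠ 1) (hQ : Q = 1 - P)
    -- every element of `𝒜₁₁` is a linear combination of elements invertible in `𝒜₁₁`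
    (hinv₁ : ∀ a : 𝒜, P * a * P ∈ Submodule.span 𝔽
      {x : 𝒜 | x = P * x * P ∧ ∃ y, y = P * y * P ∧ x * y = P ∧ y * x = P})
    -- every element of `𝒜₂₂` is a linear combination of elements invertible in `𝒜₂₂`
    (hinv₂ : ∀ a : 𝒜, Q * a * Q ∈ Submodule.span 𝔽
      {x : 𝒜 | x = Q * x * Q ∧ ∃ y, y = Q * y * Q ∧ x * y = Q ∧ y * x = Q})
    -- `𝒜₁₂` is faithful to `ℬ`
    (hlf : ∀ N : B, (∀ a : 𝒜, N * ((P * a * Q : 𝒜) : B) = 0) → N * (P : B) = 0)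
    (hrf : ∀ N : B, (∀ a : 𝒜, ((P * a * Q : 𝒜) : B) * N = 0) → (Q : B) * N = 0)
    -- `𝒜₂₁ = {0}`
    (h21 : ∀ a : 𝒜, Q * a * P = 0)
    -- `C(𝒜, ℬ) = 𝔽I`
    (hcenter : ∀ N : B, (∀ a : 𝒜, (a : B) * N = N * (a : B)) → ∃ k : 𝔽, N = k • (1 : B))
    -- `δ` is Jordan derivable at `C ∈ 𝒜`
    (C : 𝒜) (δ : 𝒜 →ₗ[𝔽] B)
    (hδ : ∀ a b : 𝒜, a * b = C →
      δ (a * b + b * a) = δ a * (b : B) + (a : B) * δ b + δ b * (a : B) + (b : B) * δ a) :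
    -- `δ` is a derivation
    ∀ a b : 𝒜, δ (a * b) = δ a * (b : B) + (a : B) * δ b := by
  have QQ : Q * Q = Q := by rw [hQ, mul_sub, mul_one, sub_mul, one_mul, hP, sub_self, sub_zero]
  have PQ : P * Q = 0 := by rw [hQ, mul_sub, mul_one, hP, sub_self]
  have QP : Q * P = 0 := by rw [hQ, sub_mul, one_mul, hP, sub_self]
  have hT : IsFaithfulTriangular P Q :=
    { idem_left := hP
      idem_right := QQ
      left_mul_right := PQ
      right_mul_left := QP
      add_eq_one := by rw [hQ]; abel
      lower_eq_zero := h21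
      faithful_left := fun N h => hlf N fun a => h _ (.sandwich hP QQ a)
      faithful_right := fun N h => hrf N fun a => h _ (.sandwich hP QQ a)
      center := hcenter }
  have hJ : IsPeirceJordan P Q δ := isPeirceJordan_of_jordanDerivableAt hchar hcard hT
    (fun x hx => by simpa [hx.1, hx.2] using hinv₁ x)
    (fun y hy => by simpa [hy.1, hy.2] using hinv₂ y) hδ
  exact hJ.leibniz hchar hT (hJ.map_one_eq_zero_of_jordanDerivableAt hchar hT hP0 hδ)
end
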